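/- arXiv:1509.06402 — 5 statements merged into one kernel-verified Lean document; each statement's English description precedes it below -/
import Mathlib

section
/- Given k ≥ 1, a sequence (m_0, m_1, …) of positive integers, sets K_j (j < ω) with |K_j| ≥ j+1, and a coloring c : ⋃_{n<ω} ⋃_{l≤n} ([K_l]^k × ∏_{j∈(n+1)∖{l}} K_j) → 2, there are infinite sets L, N ⊆ ω such that, enumerating L and N in increasing order, l_0 ≤ n_0 < l_1 ≤ n_1 < ⋯, and there are subsets H_j ⊆ K_j (j < ω) such that |H_{l_i}| = m_i for each i < ω, |H_j| = 1 for each j ∈ ω ∖ L, and c is constant on ⋃_{n∈N} ⋃_{l∈L∩(n+1)} ([H_l]^k × ∏_{j∈(n+1)∖{l}} H_j). -/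
open Classical in
noncomputable def ind (P : Prop) : ℝ := if P then 1 else 0

theorem ind_nonneg (P : Prop) : 0 ≤ ind P := by unfold ind; split_ifs <;> norm_num
theorem ind_le_one (P : Prop) : ind P ≤ 1 := by unfold ind; split_ifs <;> norm_num
theorem ind_true {P : Prop} (h : P) : ind P = 1 := by simp [ind, h]
theorem ind_false {P : Prop} (h : ¬ P) : ind P = 0 := by simp [ind, h]

noncomputable def EE (K : ℕ → Finset ℕ) : ℕ → ℕ → ((ℕ → ℕ) → ℝ) → (ℕ → ℕ) → ℝ
  | 0, _, f, x => f x
  | d + 1, s, f, x => (∑ y ∈ K s, EE K d (s + 1) f (Function.update x s y)) / (K s).card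

def Extn (K : ℕ → Finset ℕ) (s t : ℕ) (x x' : ℕ → ℕ) : Prop :=
  (∀ j, j < s ∨ t ≤ j → x' j = x j) ∧ ∀ j, s ≤ j → j < t → x' j ∈ K j

section
variable {K : ℕ → Finset ℕ} (hK : ∀ j, j + 1 ≤ (K j).card)
include hK

theorem cardpos (j : ℕ) : (0 : ℝ) < (K j).card := by
  have := hK j
  exact_mod_cast (by omega : 0 < (K j).card)

theorem EE_const (d s : ℕ) (r : ℝ) (x : ℕ → ℕ) : EE K d s (fun _ => r) x = r := by
  induction d generalizing s x with
  | zero => rfl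
  | succ d ih =>
    simp only [EE, ih, Finset.sum_const, nsmul_eq_mul]
    field_simp [(cardpos hK s).ne']

theorem EE_mono (d s : ℕ) (f g : (ℕ → ℕ) → ℝ) (x : ℕ → ℕ)
    (h : ∀ x', Extn K s (s + d) x x' → f x' ≤ g x') : EE K d s f x ≤ EE K d s g x := by
  induction d generalizing s x with
  | zero => exact h x ⟨fun _ _ => rfl, fun j h1 h2 => by omega⟩
  | succ d ih =>
    simp only [EE]
    have := cardpos hK s
    refine div_le_div_of_nonneg_right (Finset.sum_le_sum fun y hy => ih _ _ fun x' hx' => h x' ⟨?_, ?_⟩) this.le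
    · intro j hj
      rw [hx'.1 j (by omega), Function.update_of_ne (by omega)]
    · intro j h1 h2
      by_cases hj : j = s
      · subst hj
        rw [hx'.1 j (by omega)]; simpa using hy
      · exact hx'.2 j (by omega) (by omega)

omit hK in
theorem EE_add (d s : ℕ) (f g : (ℕ → ℕ) → ℝ) (x : ℕ → ℕ) :
    EE K d s (fun x => f x + g x) x = EE K d s f x + EE K d s g x := by
  induction d generalizing s x with
  | zero => rfl
  | succ d ih => simp only [EE, ih, Finset.sum_add_distrib, add_div]

omit hK in
theorem EE_smul (d s : ℕ) (r : ℝ) (f : (ℕ → ℕ) → ℝ) (x : ℕ → ℕ) :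
    EE K d s (fun x => r * f x) x = r * EE K d s f x := by
  induction d generalizing s x with
  | zero => rfl
  | succ d ih => simp only [EE, ih, ← Finset.mul_sum, mul_div_assoc]

theorem EE_sum {ι : Type*} (I : Finset ι) (d s : ℕ) (f : ι → (ℕ → ℕ) → ℝ) (x : ℕ → ℕ) :
    EE K d s (fun x => ∑ i ∈ I, f i x) x = ∑ i ∈ I, EE K d s (f i) x := by
  classical
  induction I using Finset.induction_on with
  | empty => simpa using EE_const hK d s 0 x
  | insert a I ha ih =>
    simp only [Finset.sum_insert ha, EE_add, ih]

/-- averaging over an earlier coordinate commutes -/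
theorem EE_comm (d s l : ℕ) (hl : l < s) (f : (ℕ → ℕ) → ℝ) (x : ℕ → ℕ) :
    EE K d s (fun x' => (∑ y ∈ K l, f (Function.update x' l y)) / (K l).card) x
      = (∑ y ∈ K l, EE K d s f (Function.update x l y)) / (K l).card := by
  induction d generalizing s x with
  | zero => rfl
  | succ d ih =>
    simp only [EE]
    simp only [ih (s + 1) (by omega)]
    simp only [← Finset.sum_div]
    rw [Finset.sum_comm, div_right_comm]
    congr 2
    refine Finset.sum_congr rfl fun y _ => Finset.sum_congr rfl fun y' _ => ?_
    rw [Function.update_comm (by omega)]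

theorem EE_nonneg (d s : ℕ) (f : (ℕ → ℕ) → ℝ) (x : ℕ → ℕ) (h : ∀ x, 0 ≤ f x) :
    0 ≤ EE K d s f x := by
  rw [← EE_const hK d s 0 x]
  exact EE_mono hK d s _ _ x fun x' _ => h x'

theorem EE_le_one (d s : ℕ) (f : (ℕ → ℕ) → ℝ) (x : ℕ → ℕ) (h : ∀ x, f x ≤ 1) :
    EE K d s f x ≤ 1 := by
  rw [← EE_const hK d s 1 x]
  exact EE_mono hK d s _ _ x fun x' _ => h x'

end

noncomputable def UU : Filter ℕ := (Filter.hyperfilter ℕ : Ultrafilter ℕ)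
instance : UU.NeBot := by unfold UU; infer_instance

theorem UU_le : UU ≤ Filter.atTop := by
  have := Filter.hyperfilter_le_cofinite (α := ℕ)
  rwa [Nat.cofinite_eq_atTop] at this

theorem UU_lim (u : ℕ → ℝ) (h0 : ∀ n, 0 ≤ u n) (h1 : ∀ n, u n ≤ 1) :
    Filter.Tendsto u UU (nhds (Filter.limUnder UU u)) := by
  apply tendsto_nhds_limUnder
  have hc : IsCompact (Set.Icc (0 : ℝ) 1) := isCompact_Icc
  obtain ⟨r, _, hr⟩ := hc.ultrafilter_le_nhds ((Filter.hyperfilter ℕ).map u) (by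
    simp only [Filter.le_principal_iff]
    exact Filter.mem_map.2 (Filter.Eventually.of_forall fun n => ⟨h0 n, h1 n⟩))
  exact ⟨r, hr⟩

noncomputable def Phi (K : ℕ → Finset ℕ) (D : ℕ → (ℕ → ℕ) → Prop) (s : ℕ) (x : ℕ → ℕ) : ℝ :=
  Filter.limUnder UU (fun n => EE K (n - s) s (fun x => ind (D n x)) x)

section
variable {K : ℕ → Finset ℕ} (hK : ∀ j, j + 1 ≤ (K j).card) (D : ℕ → (ℕ → ℕ) → Prop)
include hK

theorem Phi_tendsto (s : ℕ) (x : ℕ → ℕ) :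
    Filter.Tendsto (fun n => EE K (n - s) s (fun x => ind (D n x)) x) UU (nhds (Phi K D s x)) :=
  UU_lim _ (fun _ => EE_nonneg hK _ _ _ _ fun _ => ind_nonneg _)
    (fun _ => EE_le_one hK _ _ _ _ fun _ => ind_le_one _)

theorem Phi_nonneg (s : ℕ) (x : ℕ → ℕ) : 0 ≤ Phi K D s x :=
  ge_of_tendsto' (Phi_tendsto hK D s x) fun _ => EE_nonneg hK _ _ _ _ fun _ => ind_nonneg _

theorem Phi_le_one (s : ℕ) (x : ℕ → ℕ) : Phi K D s x ≤ 1 :=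
  le_of_tendsto' (Phi_tendsto hK D s x) fun _ => EE_le_one hK _ _ _ _ fun _ => ind_le_one _

theorem Phi_step (s : ℕ) (x : ℕ → ℕ) :
    Phi K D s x = (∑ y ∈ K s, Phi K D (s + 1) (Function.update x s y)) / (K s).card := by
  refine tendsto_nhds_unique (Phi_tendsto hK D s x) ?_
  have h : Filter.Tendsto (fun n => (∑ y ∈ K s, EE K (n - (s + 1)) (s + 1) (fun x => ind (D n x))
      (Function.update x s y)) / (K s).card) UU
      (nhds ((∑ y ∈ K s, Phi K D (s + 1) (Function.update x s y)) / (K s).card)) :=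
    (tendsto_finsetSum _ fun y _ => Phi_tendsto hK D (s + 1) _).div_const _
  refine h.congr' ?_
  filter_upwards [UU_le (Filter.eventually_gt_atTop s)] with n hn
  obtain ⟨d, rfl⟩ : ∃ d, n = s + 1 + d := ⟨n - (s + 1), by have : s < n := hn; omega⟩
  rw [show s + 1 + d - s = d + 1 by omega, show s + 1 + d - (s + 1) = d by omega]
  rfl

theorem Phi_iter (d s : ℕ) (x : ℕ → ℕ) :
    Phi K D s x = EE K d s (Phi K D (s + d)) x := by
  induction d generalizing s x with
  | zero => rfl
  | succ d ih =>
    rw [Phi_step hK D s x]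
    simp only [EE]
    congr 1
    refine Finset.sum_congr rfl fun y _ => ?_
    rw [ih, show s + 1 + d = s + (d + 1) by omega]

omit hK in
theorem Extn.trans {s t u : ℕ} {x y z : ℕ → ℕ} (hst : s ≤ t) (htu : t ≤ u)
    (h1 : Extn K s t x y) (h2 : Extn K t u y z) : Extn K s u x z := by
  refine ⟨fun j hj => ?_, fun j h3 h4 => ?_⟩
  · rw [h2.1 j (by omega), h1.1 j (by omega)]
  · by_cases hj : j < t
    · rw [h2.1 j (by omega)]; exact h1.2 j h3 hj
    · exact h2.2 j (by omega) h4

theorem lemA (s : ℕ) (x : ℕ → ℕ) (hpos : 0 < Phi K D s x) :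
    ∃ δ : ℝ, 0 < δ ∧ ∀ B : ℕ, ∃ n, B ≤ n ∧ s ≤ n ∧ ∃ x', Extn K s n x x' ∧ D n x' ∧
      δ ≤ Phi K D n x' := by
  set Z : Set ℝ := {r | ∃ t x', s ≤ t ∧ Extn K s t x x' ∧ r = Phi K D t x'} with hZ
  have hbdd : BddAbove Z := ⟨1, by rintro _ ⟨t, x', _, _, rfl⟩; exact Phi_le_one hK D t x'⟩
  have hmem : Phi K D s x ∈ Z := ⟨s, x, le_rfl, ⟨fun _ _ => rfl, fun j h1 h2 => by omega⟩, rfl⟩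
  set M := sSup Z with hM
  have hM0 : 0 < M := hpos.trans_le (le_csSup hbdd hmem)
  have hM1 : M ≤ 1 := csSup_le ⟨_, hmem⟩ (by rintro _ ⟨t, x', _, _, rfl⟩; exact Phi_le_one hK D t x')
  obtain ⟨_, ⟨t, x1, hst, hx1, rfl⟩, hlt⟩ := exists_lt_of_lt_csSup ⟨_, hmem⟩
    (show M - M ^ 2 / 4 < sSup Z by rw [← hM]; nlinarith [pow_pos hM0 2])
  refine ⟨M ^ 2 / 4, by positivity, fun B => ?_⟩
  by_contra hcon
  push Not at hcon
  have key : Phi K D t x1 ≤ M * (1 - Phi K D t x1) + M ^ 2 / 4 := by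
    refine ge_of_tendsto ((((Phi_tendsto hK D t x1).const_sub 1).const_mul M).add_const _) ?_
    filter_upwards [UU_le (Filter.eventually_ge_atTop (max B t))] with n hn
    have hn' : max B t ≤ n := hn
    obtain ⟨d, rfl⟩ : ∃ d, n = t + d := ⟨n - t, by omega⟩
    rw [show t + d - t = d by omega, Phi_iter hK D d t x1]
    have e : M * (1 - EE K d t (fun x => ind (D (t + d) x)) x1) + M ^ 2 / 4
        = EE K d t (fun x => (M + M ^ 2 / 4) + (-M) * ind (D (t + d) x)) x1 := by
      rw [EE_add, EE_smul, EE_const hK]; ring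
    rw [e]
    refine EE_mono hK _ _ _ _ _ fun x' hx' => ?_
    have hE := Extn.trans hst (Nat.le_add_right t d) hx1 hx'
    have hle : Phi K D (t + d) x' ≤ M := le_csSup hbdd ⟨t + d, x', by omega, hE, rfl⟩
    by_cases hD : D (t + d) x'
    · rw [ind_true hD]
      have := hcon (t + d) (by omega) (by omega) x' hE hD
      linarith
    · rw [ind_false hD]
      nlinarith [pow_pos hM0 2]
  nlinarith [pow_pos hM0 2]

theorem lemB {S : Type*} (P : S → ℕ → (ℕ → ℕ) → Prop) (I : Finset S) (l R : ℕ) (δ : ℝ)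
    (hδ : 0 < δ) (x : ℕ → ℕ) (hx : δ ≤ Phi K D l x) (hR : (R : ℝ) ≤ δ / 2 * (K l).card)
    (h : ∀ n x', l < n → ∀ Y : Finset ℕ, Y ⊆ K l → (∀ y ∈ Y, D n (Function.update x' l y)) →
      R ≤ Y.card → ∃ b ∈ I, P b n x') :
    ∃ b ∈ I, 0 < Phi K (P b) (l + 1) x := by
  classical
  by_contra hcon
  push Not at hcon
  have key : Phi K D l x ≤ δ / 2 + ∑ b ∈ I, Phi K (P b) (l + 1) x := by
    refine le_of_tendsto_of_tendsto (Phi_tendsto hK D l x)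
      ((tendsto_finsetSum I fun b _ => Phi_tendsto hK (P b) (l + 1) x).const_add (δ / 2)) ?_
    filter_upwards [UU_le (Filter.eventually_gt_atTop l)] with n hn
    have hn' : l < n := hn
    obtain ⟨d, rfl⟩ : ∃ d, n = l + 1 + d := ⟨n - (l + 1), by omega⟩
    rw [show l + 1 + d - l = d + 1 by omega, show l + 1 + d - (l + 1) = d by omega]
    simp only [EE]
    rw [← EE_comm hK d (l + 1) l (by omega), ← EE_sum hK]
    rw [← EE_const hK d (l + 1) (δ / 2) x, ← EE_add]
    refine EE_mono hK _ _ _ _ _ fun x' _ => ?_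
    set Y := (K l).filter fun y => D (l + 1 + d) (Function.update x' l y) with hY
    have hs : ∑ y ∈ K l, ind (D (l + 1 + d) (Function.update x' l y)) = Y.card := by
      rw [hY, Finset.card_filter]; push_cast
      exact Finset.sum_congr rfl fun y _ => by unfold ind; congr
    rw [hs]
    have hc := cardpos hK l
    have hsum : 0 ≤ ∑ b ∈ I, ind (P b (l + 1 + d) x') := Finset.sum_nonneg fun _ _ => ind_nonneg _
    by_cases hYR : R ≤ Y.card
    · obtain ⟨b, hb, hPb⟩ := h (l + 1 + d) x' hn' Y (Finset.filter_subset _ _)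
        (fun y hy => (Finset.mem_filter.1 hy).2) hYR
      have h1 : (1 : ℝ) ≤ ∑ b ∈ I, ind (P b (l + 1 + d) x') := by
        rw [← ind_true hPb]
        exact Finset.single_le_sum (f := fun b => ind (P b (l + 1 + d) x')) (fun _ _ => ind_nonneg _) hb
      have h2 : (Y.card : ℝ) / (K l).card ≤ 1 := by
        rw [div_le_one hc]; exact_mod_cast Finset.card_le_card (Finset.filter_subset _ _)
      linarith
    · have : (Y.card : ℝ) ≤ R := by exact_mod_cast (by omega : Y.card ≤ R)
      have h2 : (Y.card : ℝ) / (K l).card ≤ δ / 2 := by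
        rw [div_le_iff₀ hc]; linarith
      linarith
  have : ∑ b ∈ I, Phi K (P b) (l + 1) x ≤ 0 := Finset.sum_nonpos hcon
  linarith

theorem fusion {S : Type} (D : S → ℕ → (ℕ → ℕ) → Prop)
    (hdep : ∀ a n x x', (∀ j < n, x j = x' j) → D a n x → D a n x')
    (next : S → ℕ → Finset S) (bd : S → ℕ)
    (hbd : ∀ a l, bd a ≤ l → ∀ b ∈ next a l, bd b ≤ l + 1)
    (hstep : ∀ a, ∃ R : ℕ, ∀ l, bd a ≤ l → ∀ n x', l < n → ∀ Y : Finset ℕ, Y ⊆ K l →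
      (∀ y ∈ Y, D a n (Function.update x' l y)) → R ≤ Y.card → ∃ b ∈ next a l, D b n x')
    (a0 : S) (ha0 : bd a0 = 0) (hpos : ∀ x, 0 < Phi K (D a0) 0 x) :
    ∃ (a : ℕ → S) (l : ℕ → ℕ) (x : ℕ → ℕ), a 0 = a0 ∧ StrictMono l ∧ (∀ j, x j ∈ K j) ∧
      ∀ i, bd (a i) ≤ l i ∧ a (i + 1) ∈ next (a i) (l i) ∧ D (a i) (l i) x := by
  have hne : ∀ j, ∃ y, y ∈ K j := fun j =>
    Finset.card_pos.1 (lt_of_lt_of_le (Nat.succ_pos j) (hK j))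
  choose x0 hx0 using hne
  -- states: (a, s, x)
  let T := {q : S × ℕ × (ℕ → ℕ) // bd q.1 ≤ q.2.1 ∧ 0 < Phi K (D q.1) q.2.1 q.2.2 ∧
    ∀ j, q.2.2 j ∈ K j}
  have step : ∀ q : T, ∃ q' : T, ∃ l, q'.1.2.1 = l + 1 ∧ q.1.2.1 ≤ l ∧ bd q.1.1 ≤ l ∧
      q'.1.1 ∈ next q.1.1 l ∧ D q.1.1 l q'.1.2.2 ∧ ∀ j < q.1.2.1, q'.1.2.2 j = q.1.2.2 j := by
    rintro ⟨⟨a, s, x⟩, h1, h2, h3⟩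
    dsimp only at h1 h2 h3 ⊢
    obtain ⟨δ, hδ, hA⟩ := lemA hK (D a) s x h2
    obtain ⟨R, hR⟩ := hstep a
    obtain ⟨B, hB⟩ := exists_nat_ge ((R : ℝ) / (δ / 2))
    obtain ⟨n, hBn, hsn, x', hE, hDn, hPhi⟩ := hA B
    have hcard : (R : ℝ) ≤ δ / 2 * (K n).card := by
      have h4 : (B : ℝ) ≤ (K n).card := by
        have := hK n
        exact_mod_cast (by omega : B ≤ (K n).card)
      rw [div_le_iff₀ (by positivity)] at hB
      nlinarith
    obtain ⟨b, hb, hbpos⟩ := lemB hK (D a) D (next a n) n R δ hδ x' hPhi hcard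
      (hR n (by omega))
    refine ⟨⟨⟨b, n + 1, x'⟩, hbd a n (by omega) b hb, hbpos, ?_⟩, n, rfl, hsn, by omega, hb, hDn,
      fun j hj => hE.1 j (by omega)⟩
    intro j
    by_cases hj : j < s ∨ n ≤ j
    · dsimp only; rw [hE.1 j hj]; exact h3 j
    · exact hE.2 j (by omega) (by omega)
  choose F l hF using step
  let q : ℕ → T := fun i => Nat.rec ⟨⟨a0, 0, x0⟩, by simp [ha0], hpos x0, hx0⟩ (fun _ q => F q) i
  have hq : ∀ i, q (i + 1) = F (q i) := fun i => rfl
  have hl : StrictMono fun i => l (q i) := by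
    refine strictMono_nat_of_lt_succ fun i => ?_
    have h1 := (hF (q i)).1
    have h2 := (hF (q (i + 1))).2.1
    rw [hq i] at h2 ⊢
    omega
  -- stability
  have hs : ∀ i, (q (i + 1)).1.2.1 = l (q i) + 1 := fun i => by rw [hq]; exact (hF (q i)).1
  have hsi : ∀ i, i ≤ (q i).1.2.1 := by
    intro i
    cases i with
    | zero => exact Nat.zero_le _
    | succ i => rw [hs]; have := hl.id_le i; simp at this; omega
  have hsm : Monotone fun i => (q i).1.2.1 := by
    refine monotone_nat_of_le_succ fun i => ?_
    rw [hs]; have := (hF (q i)).2.1; omega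
  have hstab : ∀ i d, ∀ j < (q i).1.2.1, (q (i + d)).1.2.2 j = (q i).1.2.2 j := by
    intro i d
    induction d with
    | zero => intro j _; rfl
    | succ d ih =>
      intro j hj
      rw [← ih j hj, ← add_assoc, hq]
      exact (hF (q (i + d))).2.2.2.2.2 j (lt_of_lt_of_le hj (hsm (by omega)))
  refine ⟨fun i => (q i).1.1, fun i => l (q i), fun j => (q (j + 1)).1.2.2 j, rfl, hl,
    fun j => (q (j + 1)).2.2.2 j, fun i => ⟨(hF (q i)).2.2.1, ?_, ?_⟩⟩
  · exact (hF (q i)).2.2.2.1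
  · refine hdep _ _ _ _ ?_ (hF (q i)).2.2.2.2.1
    intro j hj
    rw [← hq]
    have h1 : j < (q (i + 1)).1.2.1 := by rw [hs]; exact Nat.lt_succ_of_lt hj
    have h2 : j < (q (j + 1)).1.2.1 := hsi (j + 1)
    rcases le_total i j with h | h
    · have := hstab (i + 1) (j - i) j h1
      rw [show i + 1 + (j - i) = j + 1 by omega] at this
      exact this.symm
    · have := hstab (j + 1) (i - j) j h2
      rw [show j + 1 + (i - j) = i + 1 by omega] at this
      exact this

end

theorem endhom {C : Type} (T : Finset C) (k : ℕ)
    (hk : ∀ q : ℕ, ∃ R : ℕ, ∀ Y : Finset ℕ, R ≤ Y.card → ∀ col : Finset ℕ → C,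
      (∀ A, col A ∈ T) → ∃ H ⊆ Y, H.card = q ∧ ∃ γ ∈ T, ∀ A ⊆ H, A.card = k → col A = γ) (N : ℕ) :
    ∃ R : ℕ, ∀ Y : Finset ℕ, R ≤ Y.card → ∀ col : Finset ℕ → C,
      (∀ A, col A ∈ T) → ∃ H ⊆ Y, H.card = N ∧ ∃ φ : ℕ → C, (∀ y, φ y ∈ T) ∧
        ∀ A ⊆ H, A.card = k + 1 → ∃ y ∈ A, col A = φ y := by
  induction N with
  | zero =>
    refine ⟨0, fun Y _ col hcol => ⟨∅, by simp, rfl, fun _ => col ∅, fun _ => hcol _, ?_⟩⟩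
    intro A hA hc
    rw [Finset.subset_empty.1 hA] at hc
    simp at hc
  | succ N ih =>
    obtain ⟨R1, h1⟩ := ih
    obtain ⟨R2, h2⟩ := hk R1
    refine ⟨R2 + 1, fun Y hY col hcol => ?_⟩
    obtain ⟨y, hy⟩ : Y.Nonempty := Finset.card_pos.1 (by omega)
    obtain ⟨Y', hY', hcY', γ, hγ, hhom⟩ := h2 (Y.erase y)
      (by rw [Finset.card_erase_of_mem hy]; omega) (fun B => col (insert y B)) (fun _ => hcol _)
    obtain ⟨H, hH, hcH, φ, hφ, hend⟩ := h1 Y' hcY'.ge col hcol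
    have hyH : y ∉ H := fun h => by simpa using hY' (hH h)
    refine ⟨insert y H, ?_, by rw [Finset.card_insert_of_notMem hyH, hcH],
      Function.update φ y γ, ?_, ?_⟩
    · intro z hz
      rcases Finset.mem_insert.1 hz with rfl | hz
      · exact hy
      · exact Finset.mem_of_mem_erase (hY' (hH hz))
    · intro z
      by_cases hz : z = y
      · subst hz; simpa using hγ
      · simpa [hz] using hφ z
    · intro A hA hc
      by_cases hyA : y ∈ A
      · refine ⟨y, hyA, ?_⟩
        have := hhom (A.erase y) (fun z hz => hH (by
          have h3 := Finset.mem_erase.1 hz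
          exact Finset.mem_of_mem_insert_of_ne (hA h3.2) h3.1))
          (by rw [Finset.card_erase_of_mem hyA]; omega)
        simp only [Finset.insert_erase hyA] at this
        simpa using this
      · obtain ⟨z, hz, e⟩ := hend A (fun z hz => Finset.mem_of_mem_insert_of_ne (hA hz)
          (fun h => hyA (h ▸ hz))) hc
        refine ⟨z, hz, ?_⟩
        rw [Function.update_of_ne (by rintro rfl; exact hyA hz), e]

theorem ramsey {C : Type} (T : Finset C) (k : ℕ) (q : ℕ) :
    ∃ R : ℕ, ∀ Y : Finset ℕ, R ≤ Y.card → ∀ col : Finset ℕ → C,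
      (∀ A, col A ∈ T) → ∃ H ⊆ Y, H.card = q ∧ ∃ γ ∈ T, ∀ A ⊆ H, A.card = k → col A = γ := by
  classical
  induction k generalizing q with
  | zero =>
    refine ⟨q, fun Y hY col hcol => ?_⟩
    obtain ⟨H, hH, hc⟩ := Finset.exists_subset_card_eq hY
    exact ⟨H, hH, hc, col ∅, hcol _, fun A _ hA => by rw [Finset.card_eq_zero.1 hA]⟩
  | succ k ih =>
    obtain ⟨R, hR⟩ := endhom T k ih (T.card * q)
    refine ⟨R, fun Y hY col hcol => ?_⟩
    obtain ⟨H, hH, hcH, φ, hφ, hend⟩ := hR Y hY col hcol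
    obtain ⟨γ, hγ, hcard⟩ := Finset.exists_le_card_fiber_of_mul_le_card_of_maps_to
      (s := H) (t := T) (f := φ) (n := q) (fun a _ => hφ a) ⟨_, hcol ∅⟩ (by rw [hcH])
    obtain ⟨H', hH', hc'⟩ := Finset.exists_subset_card_eq hcard
    refine ⟨H', fun z hz => hH (Finset.mem_filter.1 (hH' hz)).1, hc', γ, hγ, fun A hA hAc => ?_⟩
    obtain ⟨y, hy, e⟩ := hend A (fun z hz => (Finset.mem_filter.1 (hH' (hA hz))).1) hAc
    rw [e]; exact (Finset.mem_filter.1 (hH' (hA hy))).2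

theorem pointlem {K : ℕ → Finset ℕ} (hK : ∀ j, j + 1 ≤ (K j).card) (m : ℕ → ℕ)
    (g : ℕ → (ℕ → ℕ) → Bool) (hg : ∀ n w w', (∀ j < n, w j = w' j) → g n w = g n w') :
    ∃ (l : ℕ → ℕ) (H : ℕ → Finset ℕ) (ε : Bool), StrictMono l ∧ (∀ j, H j ⊆ K j) ∧
      (∀ i, (H (l i)).card = m i) ∧ (∀ j, j ∉ Set.range l → (H j).card = 1) ∧
      ∀ i w, (∀ j < l i, w j ∈ H j) → g (l i) w = ε := by
  classical
  -- choose colour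
  have hε : ∃ ε : Bool, ∀ x, 0 < Phi K (fun n x => g n x = ε) 0 x := by
    have hindep : ∀ (ε : Bool) (x x' : ℕ → ℕ), Phi K (fun n x => g n x = ε) 0 x
        = Phi K (fun n x => g n x = ε) 0 x' := by
      have aux : ∀ (ε : Bool) (n d s : ℕ) (x x' : ℕ → ℕ), s + d = n → (∀ j < s, x j = x' j) →
          EE K d s (fun x => ind (g n x = ε)) x = EE K d s (fun x => ind (g n x = ε)) x' := by
        intro ε n d
        induction d with
        | zero =>
          intro s x x' h1 h2
          simp only [EE]
          rw [hg n x x' (fun j hj => h2 j (by omega))]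
        | succ d ih =>
          intro s x x' h1 h2
          simp only [EE]
          congr 1
          refine Finset.sum_congr rfl fun y _ => ih _ _ _ (by omega) fun j hj => ?_
          by_cases hjs : j = s
          · subst hjs; simp
          · simp [hjs, h2 j (by omega)]
      intro ε x x'
      unfold Phi
      congr 1
      funext n
      exact aux ε n (n - 0) 0 x x' (by omega) (by intro j hj; omega)
    have hsum : ∀ x, Phi K (fun n x => g n x = true) 0 x + Phi K (fun n x => g n x = false) 0 x = 1 := by
      intro x
      refine tendsto_nhds_unique ((Phi_tendsto hK _ 0 x).add (Phi_tendsto hK _ 0 x)) ?_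
      refine tendsto_const_nhds.congr fun n => ?_
      rw [← EE_add, ← EE_const hK (n - 0) 0 1 x]
      congr 1
      funext x'
      cases h : g n x' <;> simp [ind]
    by_cases h : 0 < Phi K (fun n x => g n x = true) 0 0
    · exact ⟨true, fun x => by rw [hindep true x 0]; exact h⟩
    · refine ⟨false, fun x => ?_⟩
      rw [hindep false x 0]
      have := hsum 0
      linarith
  obtain ⟨ε, hε⟩ := hε
  let D : Finset ℕ × (ℕ → Finset ℕ) → ℕ → (ℕ → ℕ) → Prop := fun a n x =>
    ∀ z : ℕ → ℕ, (∀ j ∈ a.1, z j ∈ a.2 j) → (∀ j, j ∉ a.1 → z j = x j) → g n z = ε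
  let next : Finset ℕ × (ℕ → Finset ℕ) → ℕ → Finset (Finset ℕ × (ℕ → Finset ℕ)) := fun a l =>
    (Finset.powersetCard (m a.1.card) (K l)).image fun hh =>
      (insert l a.1, Function.update a.2 l hh)
  obtain ⟨a, l, x, ha0, hl, hx, hal⟩ := fusion hK D (by
      intro a n x x' h hD z hz1 hz2
      rw [← hD (fun j => if j ∈ a.1 then z j else x j) (fun j hj => by simp [hj, hz1 j hj])
        (fun j hj => by simp [hj])]
      refine hg n _ _ fun j hj => ?_
      by_cases hja : j ∈ a.1
      · simp [hja]
      · simp [hja, hz2 j hja, h j hj]) next (fun a => a.1.sup Nat.succ) (by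
      intro a l hl b hb
      obtain ⟨hh, _, rfl⟩ := Finset.mem_image.1 hb
      simp only [Finset.sup_insert]
      exact sup_le le_rfl (hl.trans (Nat.le_succ l))) (by
      intro a
      refine ⟨m a.1.card, fun l hl n x' hln Y hYK hY hR => ?_⟩
      obtain ⟨hh, hhY, hc⟩ := Finset.exists_subset_card_eq hR
      refine ⟨_, Finset.mem_image.2 ⟨hh, Finset.mem_powersetCard.2 ⟨hhY.trans hYK, hc⟩, rfl⟩, ?_⟩
      intro z hz1 hz2
      have hla : l ∉ a.1 := fun h => by
        have : Nat.succ l ≤ _ := Finset.le_sup (f := Nat.succ) h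
        omega
      refine hY (z l) (hhY ?_) z ?_ ?_
      · simpa using hz1 l (by simp)
      · intro j hj
        have := hz1 j (by simp [hj])
        rwa [show (insert l a.1, Function.update a.2 l hh).2 j = a.2 j from
          Function.update_of_ne (by rintro rfl; exact hla hj) _ _] at this
      · intro j hj
        by_cases hjl : j = l
        · subst hjl; simp
        · rw [Function.update_of_ne hjl]; exact hz2 j (by simp [hj, hjl]))
    (∅, fun _ => ∅) (by simp) (by
      intro x
      have : D (∅, fun _ => ∅) = fun n x => g n x = ε := by
        funext n x
        refine propext ⟨fun h => h x (by simp) (by simp), fun h z _ hz => ?_⟩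
        rw [show z = x from funext fun j => hz j (by simp)]; exact h
      rw [this]; exact hε x)
  have hnext : ∀ i, ∃ hh ⊆ K (l i), hh.card = m (a i).1.card ∧
      a (i + 1) = (insert (l i) (a i).1, Function.update (a i).2 (l i) hh) := by
    intro i
    obtain ⟨hh, h1, h2⟩ := Finset.mem_image.1 (hal i).2.1
    obtain ⟨h3, h4⟩ := Finset.mem_powersetCard.1 h1
    exact ⟨hh, h3, h4, h2.symm⟩
  choose hh hhK hhc hhe using hnext
  have hL : ∀ i, (a i).1 = (Finset.range i).image l := by
    intro i
    induction i with
    | zero => rw [ha0]; rfl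
    | succ i ih => rw [hhe, Finset.range_add_one, Finset.image_insert, ← ih]
  have hLc : ∀ i, (a i).1.card = i := fun i => by
    rw [hL, Finset.card_image_of_injective _ hl.injective, Finset.card_range]
  have hh2 : ∀ p i, i < p → (a p).2 (l i) = hh i := by
    intro p
    induction p with
    | zero => intro i h; omega
    | succ p ih =>
      intro i h
      rw [hhe]
      by_cases hip : i = p
      · subst hip; simp
      · rw [← ih i (by omega)]
        exact Function.update_of_ne (fun h => hip (hl.injective h)) _ _
  let H : ℕ → Finset ℕ := Function.extend l hh (fun j => {x j})
  have H1 : ∀ i, H (l i) = hh i := fun i => hl.injective.extend_apply _ _ _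
  have H2 : ∀ j, j ∉ Set.range l → H j = {x j} := fun j hj =>
    Function.extend_apply' _ _ _ (by simpa using hj)
  refine ⟨l, H, ε, hl, ?_, ?_, ?_, ?_⟩
  · intro j
    by_cases hj : j ∈ Set.range l
    · obtain ⟨i, rfl⟩ := hj
      rw [H1]; exact hhK i
    · rw [H2 j hj]; simpa using hx j
  · intro i; rw [H1, hhc, hLc]
  · intro j hj; rw [H2 j hj]; simp
  · intro i w hw
    rw [← (hal i).2.2 (fun j => if j < l i then w j else x j) ?_ ?_]
    · exact hg _ _ _ fun j hj => by simp [hj]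
    · intro j hj
      rw [hL] at hj
      obtain ⟨i', hi', rfl⟩ := Finset.mem_image.1 hj
      have hi : i' < i := by simpa using hi'
      rw [hh2 i i' hi, ← H1]
      simp only [hl hi, if_true]
      exact hw _ (hl hi)
    · intro j hj
      by_cases hji : j < l i
      · simp only [hji, if_true]
        have hjr : j ∉ Set.range l := by
          rintro ⟨i', rfl⟩
          apply hj
          rw [hL]
          exact Finset.mem_image.2 ⟨i', by simpa using hl.lt_iff_lt.1 hji, rfl⟩
        have := hw j hji
        rw [H2 j hjr] at this
        simpa using this
      · simp [hji]

structure St where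
  L : Finset ℕ
  h : ℕ → Finset ℕ
  G : ℕ → Finset (ℕ → ℕ)

open Classical in
noncomputable def restr (L : Finset ℕ) (z : ℕ → ℕ) : ℕ → ℕ := fun j => if j ∈ L then z j else 0

open Classical in
noncomputable def memB (z : ℕ → ℕ) (G : Finset (ℕ → ℕ)) : Bool := decide (z ∈ G)

def trunc (n l : ℕ) (z : ℕ → ℕ) : ℕ → ℕ := fun j => if n < j ∨ j = l then 0 else z j

theorem finV (L : Finset ℕ) (h : ℕ → Finset ℕ) :
    {z : ℕ → ℕ | (∀ j ∈ L, z j ∈ h j) ∧ ∀ j, j ∉ L → z j = 0}.Finite := by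
  classical
  have hf : (Set.pi Set.univ fun j : L => (h j : Set ℕ)).Finite :=
    Set.Finite.pi fun j => (h j).finite_toSet
  refine (hf.image fun (f : L → ℕ) (j : ℕ) => if hj : j ∈ L then f ⟨j, hj⟩ else 0).subset ?_
  rintro z ⟨h1, h2⟩
  refine ⟨fun j => z j, fun j _ => h1 j j.2, ?_⟩
  funext j
  by_cases hj : j ∈ L
  · simp [hj]
  · simp [hj, h2 j hj]

theorem step1 (k : ℕ) {K : ℕ → Finset ℕ} (hK : ∀ j, j + 1 ≤ (K j).card)
    (c : ℕ → ℕ → Finset ℕ → (ℕ → ℕ) → Bool) :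
    ∃ (l : ℕ → ℕ) (hh : ℕ → Finset ℕ) (x : ℕ → ℕ) (g : ℕ → (ℕ → ℕ) → Bool),
      StrictMono l ∧ (∀ i, hh i ⊆ K (l i)) ∧ (∀ i, (hh i).card = i + 1) ∧ (∀ j, x j ∈ K j) ∧
      (∀ n w w', (∀ j < n, w j = w' j) → g n w = g n w') ∧
      ∀ p i, i < p → ∀ A ⊆ hh i, A.card = k → ∀ z : ℕ → ℕ, (∀ j < p, z (l j) ∈ hh j) →
        (∀ j, (∀ q < p, j ≠ l q) → z j = x j) →
        c (l p - 1) (l i) A (trunc (l p - 1) (l i) z) = g i (fun j => z (l j)) := by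
  classical
  let Good : St → ℕ → (ℕ → ℕ) → Prop := fun a n x =>
    ∀ l ∈ a.L, ∀ A ⊆ a.h l, A.card = k → ∀ z : ℕ → ℕ, (∀ j ∈ a.L, z j ∈ a.h j) →
      (∀ j, j ∉ a.L → z j = x j) →
      c n l A (trunc n l z) = memB (restr (a.L.filter (· < l)) z) (a.G l)
  let D : St → ℕ → (ℕ → ℕ) → Prop := fun a n x => ∀ n', n = n' + 1 → Good a n' x
  let V : St → Finset (ℕ → ℕ) := fun a => (finV a.L a.h).toFinset
  let next : St → ℕ → Finset St := fun a l =>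
    ((Finset.powersetCard (a.L.card + 1) (K l)) ×ˢ (V a).powerset).image fun p =>
      ⟨insert l a.L, Function.update a.h l p.1, Function.update a.G l p.2⟩
  obtain ⟨a, l, x, ha0, hl, hx, hal⟩ := fusion hK D (by
      intro a n x x' h hD n' hn' l hl A hA hAc z hz1 hz2
      have := hD n' hn' l hl A hA hAc (fun j => if j ∈ a.L then z j else x j)
        (fun j hj => by simp [hj, hz1 j hj]) (fun j hj => by simp [hj])
      convert this using 2
      · funext j
        unfold trunc
        by_cases hj : n' < j ∨ j = l
        · simp [hj]
        · by_cases hja : j ∈ a.L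
          · simp [hja]
          · simp only [hj, hja, if_false]
            rw [hz2 j hja, h j (by omega)]
      · funext j
        unfold restr
        by_cases hj : j ∈ a.L
        · simp [hj]
        · simp [hj]) next (fun a => a.L.sup Nat.succ) (by
      intro a l hl b hb
      obtain ⟨hh, _, rfl⟩ := Finset.mem_image.1 hb
      simp only [Finset.sup_insert]
      exact sup_le le_rfl (hl.trans (Nat.le_succ l))) (by
      intro a
      obtain ⟨R, hR⟩ := ramsey (V a).powerset k (a.L.card + 1)
      refine ⟨R, fun l hl n x' hln Y hYK hY hRY => ?_⟩
      obtain ⟨n', rfl⟩ : ∃ n', n = n' + 1 := ⟨n - 1, by omega⟩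
      obtain ⟨hh, hhY, hc, γ, hγ, hhom⟩ := hR Y hRY
        (fun A => (V a).filter fun z => c n' l A
          (trunc n' l (fun j => if j ∈ a.L then z j else x' j)) = true)
        (fun A => Finset.mem_powerset.2 (Finset.filter_subset _ _))
      refine ⟨_, Finset.mem_image.2 ⟨(hh, γ), Finset.mem_product.2
        ⟨Finset.mem_powersetCard.2 ⟨hhY.trans hYK, hc⟩, hγ⟩, rfl⟩, ?_⟩
      have hLl : ∀ j ∈ a.L, j < l := fun j h => by
        have : Nat.succ j ≤ _ := Finset.le_sup (f := Nat.succ) h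
        omega
      have hla : l ∉ a.L := fun h => lt_irrefl _ (hLl l h)
      intro n'' hn'' l' hl' A hA hAc z hz1 hz2
      obtain rfl : n' = n'' := by omega
      dsimp only at hl' hA hz1 hz2 ⊢
      have hzL : ∀ j ∈ a.L, z j ∈ a.h j := by
        intro j hj
        have := hz1 j (by simp [hj])
        rwa [Function.update_of_ne (by rintro rfl; exact hla hj)] at this
      rcases Finset.mem_insert.1 hl' with rfl | hl'L
      · rw [Function.update_self] at hA ⊢
        have hf : (insert l' a.L).filter (· < l') = a.L := by
          ext j
          simp only [Finset.mem_filter, Finset.mem_insert]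
          constructor
          · rintro ⟨rfl | h, h'⟩
            · omega
            · exact h
          · intro h; exact ⟨Or.inr h, hLl j h⟩
        rw [hf, ← hhom A hA hAc]
        have hV : restr a.L z ∈ V a := by
          simp only [V, Set.Finite.mem_toFinset, Set.mem_setOf_eq]
          refine ⟨fun j hj => ?_, fun j hj => ?_⟩
          · simpa [restr, hj] using hzL j hj
          · simp [restr, hj]
        have ht : trunc n' l' (fun j => if j ∈ a.L then restr a.L z j else x' j)
            = trunc n' l' z := by
          funext j
          unfold trunc
          by_cases hj : n' < j ∨ j = l'
          · simp [hj]
          · simp only [hj, if_false]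
            by_cases hja : j ∈ a.L
            · simp [restr, hja]
            · simp only [hja, if_false]
              rw [hz2 j]
              simp only [Finset.mem_insert, not_or]
              exact ⟨fun h => hj (Or.inr h), hja⟩
        simp only [memB, Finset.mem_filter, hV, true_and, ht]
        simp
      · have hne : l' ≠ l := by rintro rfl; exact hla hl'L
        rw [Function.update_of_ne hne] at hA ⊢
        have hf : (insert l a.L).filter (· < l') = a.L.filter (· < l') := by
          rw [Finset.filter_insert, if_neg]
          have := hLl l' hl'L
          omega
        rw [hf]
        refine hY (z l) (hhY ?_) n' rfl l' hl'L A hA hAc z hzL ?_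
        · simpa using hz1 l (by simp)
        · intro j hj
          by_cases hjl : j = l
          · subst hjl; simp
          · rw [Function.update_of_ne hjl]; exact hz2 j (by simp [hj, hjl]))
    ⟨∅, fun _ => ∅, fun _ => ∅⟩ (by simp) (by
      intro x
      have h1 : D ⟨∅, fun _ => ∅, fun _ => ∅⟩ = fun _ _ => True := by
        funext n x
        refine eq_true ?_
        intro n' _ l hl
        simp at hl
      rw [h1]
      have : Phi K (fun _ _ => True) 0 x = 1 := by
        refine tendsto_nhds_unique (Phi_tendsto hK _ 0 x) ?_
        refine tendsto_const_nhds.congr fun n => ?_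
        simp only [ind_true trivial, EE_const hK]
      rw [this]; norm_num)
  have hnext : ∀ i, ∃ hh γ, hh ⊆ K (l i) ∧ hh.card = (a i).L.card + 1 ∧
      a (i + 1) = ⟨insert (l i) (a i).L, Function.update (a i).h (l i) hh,
        Function.update (a i).G (l i) γ⟩ := by
    intro i
    obtain ⟨⟨hh, γ⟩, h1, h2⟩ := Finset.mem_image.1 (hal i).2.1
    obtain ⟨h3, h4⟩ := Finset.mem_powersetCard.1 (Finset.mem_product.1 h1).1
    exact ⟨hh, γ, h3, h4, h2.symm⟩
  choose hh γ hhK hhc hhe using hnext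
  have hL : ∀ i, (a i).L = (Finset.range i).image l := by
    intro i
    induction i with
    | zero => rw [ha0]; rfl
    | succ i ih => rw [hhe, Finset.range_add_one, Finset.image_insert, ← ih]
  have hLc : ∀ i, (a i).L.card = i := fun i => by
    rw [hL, Finset.card_image_of_injective _ hl.injective, Finset.card_range]
  have hh2 : ∀ p i, i < p → (a p).h (l i) = hh i ∧ (a p).G (l i) = γ i := by
    intro p
    induction p with
    | zero => intro i h; omega
    | succ p ih =>
      intro i h
      rw [hhe]
      by_cases hip : i = p
      · subst hip; simp
      · rw [← (ih i (by omega)).1, ← (ih i (by omega)).2]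
        have : l i ≠ l p := fun h => hip (hl.injective h)
        exact ⟨Function.update_of_ne this _ _, Function.update_of_ne this _ _⟩
  refine ⟨l, hh, x, fun i w => memB (restr ((Finset.range i).image l)
    (Function.extend l w 0)) (γ i), hl, hhK, fun i => by rw [hhc, hLc], hx, ?_, ?_⟩
  · intro n w w' h
    have : restr ((Finset.range n).image l) (Function.extend l w 0)
        = restr ((Finset.range n).image l) (Function.extend l w' 0) := by
      funext j
      unfold restr
      by_cases hj : j ∈ (Finset.range n).image l
      · rw [if_pos hj, if_pos hj]
        obtain ⟨i, hi, rfl⟩ := Finset.mem_image.1 hj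
        rw [hl.injective.extend_apply, hl.injective.extend_apply, h i (by simpa using hi)]
      · rw [if_neg hj, if_neg hj]
    simp only [this]
  · intro p i hip A hA hAc z hz1 hz2
    have hlp : l p = l p - 1 + 1 := by have := hl hip; omega
    have := (hal p).2.2 (l p - 1) hlp (l i) (by
      rw [hL]; exact Finset.mem_image.2 ⟨i, by simpa using hip, rfl⟩) A
      (by rw [(hh2 p i hip).1]; exact hA) hAc z (by
        intro j hj
        rw [hL] at hj
        obtain ⟨q, hq, rfl⟩ := Finset.mem_image.1 hj
        have hq : q < p := by simpa using hq
        rw [(hh2 p q hq).1]; exact hz1 q hq) (by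
        intro j hj
        refine hz2 j fun q hq e => hj ?_
        rw [hL, e]
        exact Finset.mem_image.2 ⟨q, by simpa using hq, rfl⟩)
    rw [this, (hh2 p i hip).2]
    have hf : (a p).L.filter (· < l i) = (Finset.range i).image l := by
      ext j
      rw [hL]
      simp only [Finset.mem_filter, Finset.mem_image, Finset.mem_range]
      constructor
      · rintro ⟨⟨q, hq, rfl⟩, h⟩
        exact ⟨q, hl.lt_iff_lt.1 h, rfl⟩
      · rintro ⟨q, hq, rfl⟩
        exact ⟨⟨q, by omega, rfl⟩, hl hq⟩
    rw [hf]
    have : restr ((Finset.range i).image l) z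
        = restr ((Finset.range i).image l) (Function.extend l (fun j => z (l j)) 0) := by
      funext j
      unfold restr
      by_cases hj : j ∈ (Finset.range i).image l
      · rw [if_pos hj, if_pos hj]
        obtain ⟨i, hi, rfl⟩ := Finset.mem_image.1 hj
        rw [hl.injective.extend_apply]
      · rw [if_neg hj, if_neg hj]
    rw [this]

theorem stmt0 (k : ℕ) (hk : 1 ≤ k) (m : ℕ → ℕ) (hm : ∀ i, 1 ≤ m i)
    (K : ℕ → Finset ℕ) (hK : ∀ j, j + 1 ≤ (K j).card)
    (c : ℕ → ℕ → Finset ℕ → (ℕ → ℕ) → Bool) :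
    ∃ l n : ℕ → ℕ, StrictMono l ∧ StrictMono n ∧
      (∀ i, l i ≤ n i) ∧ (∀ i, n i < l (i + 1)) ∧
      ∃ H : ℕ → Finset ℕ, (∀ j, H j ⊆ K j) ∧
        (∀ i, (H (l i)).card = m i) ∧
        (∀ j, j ∉ Set.range l → (H j).card = 1) ∧
        ∃ ε : Bool, ∀ p i, l i ≤ n p →
          ∀ A : Finset ℕ, A ⊆ H (l i) → A.card = k →
          ∀ x : ℕ → ℕ, (∀ j, j ≤ n p → j ≠ l i → x j ∈ H j) →
            (∀ j, n p < j ∨ j = l i → x j = 0) →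
            c (n p) (l i) A x = ε := by
  classical
  obtain ⟨l, hh, x0, g, hl, hhK, hhc, hx0, hg, hmain⟩ := step1 k hK c
  obtain ⟨l', H', ε, hl', hH'K, hH'c, hH'1, hH'g⟩ := pointlem (K := hh) (fun j => (hhc j).ge) m g hg
  let H : ℕ → Finset ℕ := Function.extend l H' (fun j => {x0 j})
  have H1 : ∀ i, H (l i) = H' i := fun i => hl.injective.extend_apply _ _ _
  have H2 : ∀ j, j ∉ Set.range l → H j = {x0 j} := fun j hj =>
    Function.extend_apply' _ _ _ (by simpa using hj)
  have hH'ne : ∀ i, (H' i).Nonempty := by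
    intro i
    rw [← Finset.card_pos]
    by_cases hi : i ∈ Set.range l'
    · obtain ⟨q, rfl⟩ := hi
      rw [hH'c]; exact hm q
    · rw [hH'1 i hi]; norm_num
  have hlt : ∀ i, l i < l (i + 1) := fun i => hl (Nat.lt_succ_self i)
  refine ⟨fun i => l (l' i), fun i => l (l' i + 1) - 1, hl.comp hl', ?_, ?_, ?_, H, ?_, ?_, ?_, ε, ?_⟩
  · intro i j hij
    have h1 : l (l' i + 1) < l (l' j + 1) := hl (by have := hl' hij; omega)
    have h2 := hlt (l' i)
    dsimp only
    omega
  · intro i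
    have := hlt (l' i)
    dsimp only
    omega
  · intro i
    have h1 : l (l' i + 1) ≤ l (l' (i + 1)) := hl.monotone (hl' (Nat.lt_succ_self i))
    have := hlt (l' i)
    dsimp only
    omega
  · intro j
    by_cases hj : j ∈ Set.range l
    · obtain ⟨i, rfl⟩ := hj
      rw [H1]; exact (hH'K i).trans (hhK i)
    · rw [H2 j hj]; simpa using hx0 j
  · intro i; rw [H1, hH'c]
  · intro j hj
    by_cases hjl : j ∈ Set.range l
    · obtain ⟨i, rfl⟩ := hjl
      rw [H1]
      refine hH'1 i ?_
      rintro ⟨q, rfl⟩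
      exact hj ⟨q, rfl⟩
    · rw [H2 j hjl]; simp
  · intro p i hip A hA hAc X hX1 hX2
    dsimp only at hip hA hX1 hX2 ⊢
    rw [H1] at hA
    set P := l' p + 1 with hP
    have hPpos : l (l' p) < l P := hlt _
    have hiP : l' i < P := hl.lt_iff_lt.1 (by omega)
    obtain ⟨y0, hy0⟩ := hH'ne (l' i)
    let z : ℕ → ℕ := fun j => if j = l (l' i) then y0 else if l P - 1 < j then x0 j else X j
    have hz : ∀ q < P, z (l q) ∈ H' q := by
      intro q hq
      have hqn : ¬ (l P - 1 < l q) := by have := hl hq; omega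
      by_cases hqi : q = l' i
      · subst hqi; simpa [z] using hy0
      · have hne : l q ≠ l (l' i) := fun h => hqi (hl.injective h)
        simp only [z, hne, hqn, if_false]
        rw [← H1]
        exact hX1 _ (by omega) hne
    have := hmain P (l' i) hiP A (hA.trans (hH'K _)) hAc z (fun q hq => hH'K _ (hz q hq)) (by
      intro j hj
      have hne : j ≠ l (l' i) := hj _ hiP
      by_cases hjn : l P - 1 < j
      · simp [z, hne, hjn]
      · simp only [z, hne, hjn, if_false]
        have hjr : j ∉ Set.range l := by
          rintro ⟨q, rfl⟩
          exact hj q (hl.lt_iff_lt.1 (by omega)) rfl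
        have := hX1 j (by omega) hne
        rw [H2 j hjr] at this
        simpa using this)
    rw [hH'g i (fun j => z (l j)) (fun j hj => hz j (by omega))] at this
    rw [← this]
    congr 1
    funext j
    unfold trunc
    by_cases hj : l P - 1 < j ∨ j = l (l' i)
    · rw [if_pos hj]; exact hX2 j hj
    · rw [if_neg hj]
      rw [not_or] at hj
      simp only [z, hj.1, hj.2, if_false]
end

section
/- There is a function R : [ℕ⁺]^{<ω} → ℕ⁺ such that for every infinite sequence (m_j)_{j<ω} of positive integers and for every coloring c : ⋃_{n<ω} ∏_{j≤n} R(m_0, …, m_j) → 2, there exist sets H_j ⊆ R(m_0, …, m_j) with |H_j| = m_j for each j < ω, such that c is constant on the product ∏_{j≤n} H_j for infinitely many n < ω. -/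
namespace PT

def Big (m B : ℕ → ℕ) (j t : ℕ) (A : Finset ℕ) : Prop := m j * B j ^ t ≤ A.card

def Hom (c : ℕ → (ℕ → ℕ) → Bool) (e : Bool) (n : ℕ) (q : ℕ → Finset ℕ) : Prop :=
  ∀ x : ℕ → ℕ, (∀ j, j ≤ n → x j ∈ q j) → (∀ j, n < j → x j = 0) → c n x = e

def Good (m B : ℕ → ℕ) (c : ℕ → (ℕ → ℕ) → Bool) (e : Bool) (k : ℕ) (p : ℕ → Finset ℕ)
    (v u D : ℕ → ℕ) : Prop :=
  ∀ (r s : ℕ → ℕ) (q : ℕ → Finset ℕ),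
    (∀ j, k ≤ j → v j ≤ r j ∧ r j + D j ≤ s j ∧ s j ≤ u j) →
    (∀ j, q j ⊆ p j) → (∀ j, j < k → q j = p j) → (∀ j, k ≤ j → Big m B j (s j) (q j)) →
    ∀ N, ∃ n, N ≤ n ∧ ∃ q' : ℕ → Finset ℕ, (∀ j, q' j ⊆ q j) ∧ (∀ j, j < k → q' j = q j) ∧
      (∀ j, k ≤ j → Big m B j (r j) (q' j)) ∧ Hom c e n q'

theorem Hom.mono {c e n} {q q' : ℕ → Finset ℕ} (h : Hom c e n q) (hq : ∀ j, q' j ⊆ q j) :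
    Hom c e n q' := fun x hx h0 => h x (fun j hj => hq j (hx j hj)) h0

theorem Big.mono {m B : ℕ → ℕ} (hB : ∀ j, 1 ≤ B j) {j t t' : ℕ} {A : Finset ℕ}
    (h : Big m B j t A) (ht : t' ≤ t) : Big m B j t' A :=
  le_trans (Nat.mul_le_mul_left _ (Nat.pow_le_pow_right (hB j) ht)) h

theorem Good.mono {m B c e k} {p p' : ℕ → Finset ℕ} {v u v' u' D : ℕ → ℕ}
    (h : Good m B c e k p v u D) (hp : ∀ j, p' j ⊆ p j) (hk : ∀ j, j < k → p' j = p j)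
    (hv : ∀ j, k ≤ j → v j ≤ v' j) (hu : ∀ j, k ≤ j → u' j ≤ u j) :
    Good m B c e k p' v' u' D := by
  intro r s q h1 h2 h3 h4
  exact h r s q (fun j hj => ⟨(hv j hj).trans (h1 j hj).1, (h1 j hj).2.1,
    (h1 j hj).2.2.trans (hu j hj)⟩) (fun j => (h2 j).trans (hp j))
    (fun j hj => (h3 j hj).trans (hk j hj)) h4

theorem inner (m B : ℕ → ℕ) (hB : ∀ j, 1 ≤ B j) (c : ℕ → (ℕ → ℕ) → Bool) (e : Bool) (k : ℕ)
    (C D : ℕ → ℕ) (A : Finset ℕ) (t : ℕ) :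
    ∀ (F : Finset (Finset ℕ)) (q : ℕ → Finset ℕ) (v w : ℕ → ℕ), F.card = t →
    (∀ S ∈ F, S ⊆ A ∧ S.card = m k) → q k = A →
    (∀ j, k + 1 ≤ j → v j + C j ^ t * D j ≤ w j) → v k + D k ≤ w k →
    (∀ j, k ≤ j → Big m B j (w j) (q j)) → Good m B c e k q v w D →
    (∀ S, S ⊆ A → S.card = m k → S ∉ F → ∃ N, ∀ n, N ≤ n → ∀ q' : ℕ → Finset ℕ,
      (∀ j, q' j ⊆ q j) → (∀ j, j < k → q' j = q j) → q' k = S →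
      (∀ j, k + 1 ≤ j → Big m B j (v j) (q' j)) → ¬ Hom c e n q') →
    ∃ (p' : ℕ → Finset ℕ) (v' w' D' : ℕ → ℕ), (∀ j, p' j ⊆ q j) ∧ (∀ j, j < k → p' j = q j) ∧
      (p' k).card = m k ∧ (∀ j, k + 1 ≤ j → Big m B j (w' j) (p' j)) ∧
      (∀ j, k + 1 ≤ j → v' j + C j * D' j ≤ w' j) ∧ Good m B c e (k+1) p' v' w' D' := by
  induction t with
  | zero =>
    intro F q v w hF _ hqk hlen hlenk hbig hgood hdead
    exfalso
    have hF0 : F = ∅ := Finset.card_eq_zero.mp hF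
    subst hF0
    have : ∀ S, ∃ N, S ⊆ A → S.card = m k → ∀ n, N ≤ n → ∀ q' : ℕ → Finset ℕ,
      (∀ j, q' j ⊆ q j) → (∀ j, j < k → q' j = q j) → q' k = S →
      (∀ j, k + 1 ≤ j → Big m B j (v j) (q' j)) → ¬ Hom c e n q' := by
      intro S
      by_cases h1 : S ⊆ A ∧ S.card = m k
      · obtain ⟨N, hN⟩ := hdead S h1.1 h1.2 (by simp)
        exact ⟨N, fun _ _ => hN⟩
      · exact ⟨0, fun a b => absurd ⟨a, b⟩ h1⟩
    choose N hN using this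
    obtain ⟨n, hn, q', h1, h2, h3, h4⟩ := hgood v w q (fun j hj => ⟨le_rfl, by
      rcases hj.eq_or_lt with rfl | hj
      · exact hlenk
      · simpa using hlen j hj, le_rfl⟩) (fun j => subset_rfl) (fun j _ => rfl) hbig
      (A.powerset.sup N)
    have hk : m k ≤ (q' k).card := by
      refine le_trans ?_ (h3 k le_rfl)
      exact Nat.le_mul_of_pos_right _ (Nat.pow_pos (hB k))
    obtain ⟨S, hS, hSc⟩ := Finset.exists_subset_card_eq hk
    have hSA : S ⊆ A := by rw [← hqk]; exact hS.trans (h1 k)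
    have hsub : ∀ j, Function.update q' k S j ⊆ q' j := by
      intro j
      by_cases hj : j = k
      · subst hj; simpa using hS
      · simp [hj]
    refine hN S hSA hSc n (le_trans (Finset.le_sup (f := N) (Finset.mem_powerset.mpr hSA)) hn)
      (Function.update q' k S) (fun j => (hsub j).trans (h1 j)) ?_ (by simp) ?_ (h4.mono hsub)
    · intro j hj
      rw [Function.update_of_ne (by omega)]; exact h2 j hj
    · intro j hj
      rw [Function.update_of_ne (by omega)]; exact h3 j (by omega)
  | succ t ih =>
    intro F q v w hF hFA hqk hlen hlenk hbig hgood hdead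
    obtain ⟨S, hSF⟩ : F.Nonempty := by rw [← Finset.card_pos]; omega
    have hsub : ∀ j, Function.update q k S j ⊆ q j := by
      intro j
      by_cases hj : j = k
      · subst hj; simpa [hqk] using (hFA S hSF).1
      · simp [hj]
    by_cases hg : Good m B c e (k+1) (Function.update q k S) v w (fun j => C j ^ t * D j)
    · refine ⟨Function.update q k S, v, w, fun j => C j ^ t * D j, hsub, ?_, ?_, ?_, ?_, hg⟩
      · intro j hj
        rw [Function.update_of_ne (by omega)]
      · simpa using (hFA S hSF).2
      · intro j hj
        rw [Function.update_of_ne (by omega)]; exact hbig j (by omega)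
      · intro j hj
        have := hlen j hj
        rw [pow_succ] at this
        calc _ = v j + C j ^ t * C j * D j := by ring
          _ ≤ _ := this
    · unfold Good at hg
      push Not at hg
      obtain ⟨r, s, q1, h1, h2, h3, h4, N, h5⟩ := hg
      set qn := Function.update q1 k A with hqn
      have hq1k : q1 k = S := by rw [h3 k (by omega)]; simp
      have hne : ∀ j, j ≠ k → qn j = q1 j := fun j hj => by simp [hqn, hj]
      have hqnq : ∀ j, qn j ⊆ q j := by
        intro j
        by_cases hj : j = k
        · subst hj; simp [hqn, hqk]
        · rw [hne j hj]; exact (h2 j).trans (hsub j)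
      have hqnlt : ∀ j, j < k → qn j = q j := by
        intro j hj
        rw [hne j (by omega), h3 j (by omega), Function.update_of_ne (by omega)]
      have hgr : ∀ j, k + 1 ≤ j → Function.update r k (v k) j = r j :=
        fun j hj => Function.update_of_ne (by omega) _ _
      have hgs : ∀ j, k + 1 ≤ j → Function.update s k (w k) j = s j :=
        fun j hj => Function.update_of_ne (by omega) _ _
      obtain ⟨p', v', w', D', g1, g2, g3⟩ := ih (F.erase S) qn (Function.update r k (v k))
        (Function.update s k (w k))
        (by rw [Finset.card_erase_of_mem hSF]; omega)
        (fun T hT => hFA T (Finset.mem_of_mem_erase hT)) (by simp [hqn])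
        (fun j hj => by rw [hgr j hj, hgs j hj]; exact (h1 j hj).2.1)
        (by simpa using hlenk)
        (by
          intro j hj
          rcases hj.eq_or_lt with rfl | hj
          · simpa [hqn, hqk] using hbig k le_rfl
          · rw [hgs j hj, hne j (by omega)]; exact h4 j hj)
        (by
          refine hgood.mono hqnq hqnlt ?_ ?_
          · intro j hj
            rcases hj.eq_or_lt with rfl | hj
            · simp
            · rw [hgr j hj]; exact (h1 j hj).1
          · intro j hj
            rcases hj.eq_or_lt with rfl | hj
            · simp
            · rw [hgs j hj]; exact (h1 j hj).2.2)
        (by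
          intro T hTA hTc hTF
          by_cases hTS : T = S
          · subst hTS
            refine ⟨N, fun n hn q' a1 a2 a3 a4 => h5 n hn q' ?_ ?_ ?_⟩
            · intro j
              by_cases hj : j = k
              · subst hj; rw [a3, hq1k]
              · rw [← hne j hj]; exact a1 j
            · intro j hj
              by_cases hj' : j = k
              · subst hj'; rw [a3, hq1k]
              · rw [← hne j hj']; exact a2 j (by omega)
            · intro j hj
              rw [← hgr j hj]; exact a4 j hj
          · obtain ⟨N', hN'⟩ := hdead T hTA hTc (fun h => hTF (Finset.mem_erase.mpr ⟨hTS, h⟩))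
            refine ⟨N', fun n hn q' a1 a2 a3 a4 => hN' n hn q' (fun j => (a1 j).trans (hqnq j))
              (fun j hj => (a2 j hj).trans (hqnlt j hj)) a3 ?_⟩
            intro j hj
            refine (a4 j hj).mono hB ?_
            rw [hgr j hj]; exact (h1 j hj).1)
      exact ⟨p', v', w', D', fun j => (g1 j).trans (hqnq j),
        fun j hj => (g2 j hj).trans (hqnlt j hj), g3⟩

structure St (m B R : ℕ → ℕ) (C : ℕ → ℕ → ℕ) (c : ℕ → (ℕ → ℕ) → Bool) (e : Bool) (k : ℕ)
    (p : ℕ → Finset ℕ) : Prop where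
  sub : ∀ j, p j ⊆ Finset.range (R j)
  card : ∀ j, j < k → (p j).card = m j
  ex : ∃ v u D : ℕ → ℕ, (∀ j, k ≤ j → Big m B j (u j) (p j)) ∧
    (∀ j, k ≤ j → v j + C k j * D j ≤ u j) ∧ Good m B c e k p v u D

theorem step (m B R : ℕ → ℕ) (C : ℕ → ℕ → ℕ) (hB : ∀ j, 1 ≤ B j) (hC1 : ∀ k j, 1 ≤ C k j)
    (hC : ∀ k j, k ≤ j → C (k+1) j ^ (2 ^ R k) + 1 ≤ C k j)
    (c : ℕ → (ℕ → ℕ) → Bool) (e : Bool) (k : ℕ) (p : ℕ → Finset ℕ) (h : St m B R C c e k p) :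
    ∃ p', St m B R C c e (k+1) p' ∧ (∀ j, p' j ⊆ p j) ∧ (∀ j, j < k → p' j = p j) ∧
      ∃ n, k ≤ n ∧ Hom c e n p' := by
  obtain ⟨hsub, hcard, v, u, D, hbig, hlen, hgood⟩ := h
  have hlen' : ∀ j, k ≤ j → v j + C (k+1) j ^ (2 ^ R k) * D j + D j ≤ u j := by
    intro j hj
    refine le_trans ?_ (hlen j hj)
    have := Nat.mul_le_mul_right (D j) (hC k j hj)
    rw [add_mul, one_mul] at this
    omega
  have hpow : ∀ j t, t ≤ 2 ^ R k → C (k+1) j ^ t * D j ≤ C (k+1) j ^ (2 ^ R k) * D j :=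
    fun j t ht => Nat.mul_le_mul_right _ (Nat.pow_le_pow_right (hC1 _ _) ht)
  have hD : ∀ j, D j ≤ C (k+1) j ^ (2 ^ R k) * D j := by
    intro j; simpa using hpow j 0 (Nat.zero_le _)
  obtain ⟨n, hn, q, h1, h2, h3, h4⟩ := hgood (fun j => u j - D j) u p
    (fun j hj => by have := hlen' j hj; have := hD j; (try dsimp only); omega)
    (fun j => subset_rfl) (fun _ _ => rfl) hbig k
  have hcardle : ((q k).powerset.filter (fun S => S.card = m k)).card ≤ 2 ^ R k := by
    refine (Finset.card_filter_le _ _).trans ?_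
    rw [Finset.card_powerset]
    refine Nat.pow_le_pow_right (by norm_num) ?_
    simpa using Finset.card_le_card ((h1 k).trans (hsub k))
  obtain ⟨p', v', w', D', g1, g2, g3, g4, g5, g6⟩ := inner m B hB c e k (C (k+1)) D (q k) _
    ((q k).powerset.filter (fun S => S.card = m k)) q v (fun j => u j - D j) rfl
    (fun S hS => by simpa using hS) rfl
    (fun j hj => by
      have := hlen' j (by omega); have := hpow j _ hcardle; (try dsimp only); omega)
    (by have := hlen' k le_rfl; have := hD k; (try dsimp only); omega)
    h3 (hgood.mono h1 h2 (fun _ _ => le_rfl) (fun _ _ => Nat.sub_le _ _))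
    (fun S hS hSc hSF => absurd (by simpa using ⟨hS, hSc⟩) hSF)
  refine ⟨p', ⟨fun j => (g1 j).trans ((h1 j).trans (hsub j)), ?_, v', w', D', g4, g5, g6⟩,
    fun j => (g1 j).trans (h1 j), fun j hj => (g2 j hj).trans (h2 j hj), n, hn, h4.mono g1⟩
  intro j hj
  rcases (Nat.lt_succ_iff.mp hj).eq_or_lt with rfl | hj
  · exact g3
  · rw [g2 j hj, h2 j hj, hcard j hj]

theorem pigeon (R B a : ℕ → ℕ) (q : ℕ → Finset ℕ) (hq : ∀ j, q j ⊆ Finset.range (R j))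
    (hBR : ∀ j, B j = 2 ^ (∏ i ∈ Finset.range j, R i))
    (ha : ∀ j, 1 ≤ a j) (hqa : ∀ j, a j * B j ≤ (q j).card) (k : ℕ) :
    ∀ g : (ℕ → ℕ) → Bool, (∀ x y : ℕ → ℕ, (∀ j, j < k → x j = y j) → g x = g y) →
    ∃ q' : ℕ → Finset ℕ, (∀ j, q' j ⊆ q j) ∧ (∀ j, a j ≤ (q' j).card) ∧
      ∃ e, ∀ x : ℕ → ℕ, (∀ j, j < k → x j ∈ q' j) → g x = e := by
  induction k with
  | zero =>
    intro g hg
    refine ⟨q, fun _ => subset_rfl, fun j => ?_, g 0, fun x _ => hg _ _ (by simp)⟩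
    refine le_trans (Nat.le_mul_of_pos_right _ ?_) (hqa j)
    rw [hBR]; positivity
  | succ k ih =>
    intro g hg
    let X := Fintype.piFinset (fun j : Fin k => Finset.range (R j))
    let ext : (Fin k → ℕ) → ℕ → ℕ → ℕ := fun f y i => if h : i < k then f ⟨i, h⟩ else y
    let col : ℕ → (X → Bool) := fun y f => g (ext f.1 y)
    have hX : Fintype.card (X → Bool) = B k := by
      rw [hBR, Fintype.card_fun]
      simp [X, Fintype.card_piFinset, Finset.prod_range]
    obtain ⟨f, -, hf⟩ := Finset.exists_le_card_fiber_of_mul_le_card_of_maps_to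
      (s := q k) (t := (Finset.univ : Finset (X → Bool))) (f := col) (n := a k)
      (fun _ _ => Finset.mem_univ _) ⟨fun _ => true, Finset.mem_univ _⟩
      (by rw [Finset.card_univ, hX, mul_comm]; exact hqa k)
    set T := (q k).filter (fun y => col y = f) with hT
    obtain ⟨y0, hy0⟩ : T.Nonempty := by
      rw [← Finset.card_pos]; exact lt_of_lt_of_le (ha k) hf
    obtain ⟨q', h1, h2, e, h3⟩ := ih (fun x => g (Function.update x k y0)) (by
      intro x y hxy
      apply hg
      intro j hj
      by_cases hjk : j = k
      · subst hjk; simp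
      · simp [hjk, hxy j (by omega)])
    refine ⟨Function.update q' k T, ?_, ?_, e, ?_⟩
    · intro j
      by_cases hjk : j = k
      · subst hjk; simp [hT]
      · simpa [hjk] using h1 j
    · intro j
      by_cases hjk : j = k
      · subst hjk; simpa using hf
      · simpa [hjk] using h2 j
    · intro x hx
      have hx' : ∀ j, j < k → x j ∈ q' j := by
        intro j hj
        have := hx j (by omega)
        rwa [Function.update_of_ne (by omega)] at this
      rw [← h3 x hx']
      have hxk : x k ∈ T := by simpa using hx k (by omega)
      have e1 : col (x k) = col y0 := by
        rw [(Finset.mem_filter.mp hxk).2, (Finset.mem_filter.mp hy0).2]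
      have hmem : (fun i : Fin k => x i) ∈ X := by
        rw [Fintype.mem_piFinset]
        intro i
        exact hq _ (h1 _ (hx' i i.2))
      have e2 := congrFun e1 ⟨_, hmem⟩
      have e3 : g x = col (x k) ⟨_, hmem⟩ := by
        apply hg
        intro j hj
        by_cases hjk : j < k
        · simp [ext, hjk]
        · have : j = k := by omega
          subst this; simp [ext]
      have e4 : col y0 ⟨_, hmem⟩ = g (Function.update x k y0) := by
        apply hg
        intro j hj
        by_cases hjk : j < k
        · rw [Function.update_of_ne (by omega)]; simp [ext, hjk]
        · have : j = k := by omega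
          subst this; simp [ext]
      rw [e3, e2, e4]

theorem pigeon' (R B a : ℕ → ℕ) (q : ℕ → Finset ℕ) (hq : ∀ j, q j ⊆ Finset.range (R j))
    (hBR : ∀ j, B j = 2 ^ (∏ i ∈ Finset.range j, R i))
    (ha : ∀ j, 1 ≤ a j) (hqa : ∀ j, a j * B j ≤ (q j).card) (c : ℕ → (ℕ → ℕ) → Bool) (n : ℕ) :
    ∃ q' : ℕ → Finset ℕ, (∀ j, q' j ⊆ q j) ∧ (∀ j, a j ≤ (q' j).card) ∧
      ∃ e, Hom c e n q' := by
  obtain ⟨q', h1, h2, e, h3⟩ := pigeon R B a q hq hBR ha hqa (n+1)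
    (fun x => c n (fun j => if j < n + 1 then x j else 0)) (by
      intro x y hxy
      (try dsimp only)
      congr 1
      funext j
      split_ifs with h
      · exact hxy j h
      · rfl)
  refine ⟨q', h1, h2, e, fun x hx h0 => ?_⟩
  rw [← h3 x (fun j hj => hx j (by omega))]
  congr 1
  funext j
  split_ifs with h
  · rfl
  · exact h0 j (by omega)

theorem start (m B R : ℕ → ℕ) (C : ℕ → ℕ → ℕ) (hm : ∀ j, 1 ≤ m j)
    (hBR : ∀ j, B j = 2 ^ (∏ i ∈ Finset.range j, R i))
    (hR : ∀ j, m j * B j ^ (C 0 j ^ 2) ≤ R j)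
    (c : ℕ → (ℕ → ℕ) → Bool) : ∃ e p, St m B R C c e 0 p := by
  have hB : ∀ j, 1 ≤ B j := fun j => by rw [hBR]; exact Nat.one_le_two_pow
  by_cases hg : Good m B c true 0 (fun j => Finset.range (R j)) (fun _ => 0)
      (fun j => C 0 j ^ 2) (C 0)
  · exact ⟨true, fun j => Finset.range (R j), fun _ => subset_rfl, fun j hj => by omega,
      fun _ => 0, fun j => C 0 j ^ 2, C 0, fun j _ => by simpa [Big] using hR j,
      fun j _ => by (try dsimp only); rw [sq]; omega, hg⟩
  · unfold Good at hg
    push Not at hg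
    obtain ⟨r, s, q, h1, h2, h3, h4, N, h5⟩ := hg
    refine ⟨false, q, h2, fun j hj => by omega, r, s, fun _ => 1, h4, fun j hj => by
      simpa using (h1 j hj).2.1, ?_⟩
    intro r' s' q1 g1 g2 g3 g4 N'
    obtain ⟨q', a1, a2, e, a3⟩ := pigeon' R B (fun j => m j * B j ^ (r' j)) q1
      (fun j => (g2 j).trans (h2 j)) hBR
      (fun j => Nat.mul_pos (hm j) (Nat.pow_pos (hB j))) (by
        intro j
        have : Big m B j (r' j + 1) (q1 j) :=
          (g4 j (Nat.zero_le _)).mono hB (g1 j (Nat.zero_le _)).2.1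
        unfold Big at this
        rw [pow_succ, ← mul_assoc] at this
        exact this) c (max N N')
    refine ⟨max N N', le_max_right _ _, q', a1, fun j hj => by omega, fun j _ => a2 j, ?_⟩
    cases e with
    | false => exact a3
    | true =>
      exfalso
      refine h5 (max N N') (le_max_left _ _) q' (fun j => (a1 j).trans (g2 j))
        (fun j hj => by omega) (fun j hj => ?_) a3
      exact Big.mono hB (a2 j) (g1 j hj).1

theorem core (m B R : ℕ → ℕ) (C : ℕ → ℕ → ℕ) (hm : ∀ j, 1 ≤ m j)
    (hBR : ∀ j, B j = 2 ^ (∏ i ∈ Finset.range j, R i))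
    (hC1 : ∀ k j, 1 ≤ C k j)
    (hC : ∀ k j, k ≤ j → C (k+1) j ^ (2 ^ R k) + 1 ≤ C k j)
    (hR : ∀ j, m j * B j ^ (C 0 j ^ 2) ≤ R j)
    (c : ℕ → (ℕ → ℕ) → Bool) :
    ∃ H : ℕ → Finset ℕ, (∀ j, H j ⊆ Finset.range (R j)) ∧ (∀ j, (H j).card = m j) ∧
      {n : ℕ | ∃ ε : Bool, ∀ x : ℕ → ℕ, (∀ j, j ≤ n → x j ∈ H j) → (∀ j, n < j → x j = 0) →
              c n x = ε}.Infinite := by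
  have hB : ∀ j, 1 ≤ B j := fun j => by rw [hBR]; exact Nat.one_le_two_pow
  obtain ⟨e, p0, hp0⟩ := start m B R C hm hBR hR c
  choose f hf1 hf2 hf3 hf4 using step m B R C hB hC1 hC c e
  let P : (k : ℕ) → {p // St m B R C c e k p} := fun k =>
    Nat.rec ⟨p0, hp0⟩ (fun k p => ⟨f k p.1 p.2, hf1 k p.1 p.2⟩) k
  have hP1 : ∀ k j, (P (k+1)).1 j ⊆ (P k).1 j := fun k => hf2 k (P k).1 (P k).2
  have hP2 : ∀ k j, j < k → (P (k+1)).1 j = (P k).1 j := fun k => hf3 k (P k).1 (P k).2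
  have hP3 : ∀ k, ∃ n, k ≤ n ∧ Hom c e n (P (k+1)).1 := fun k => hf4 k (P k).1 (P k).2
  have hanti : ∀ j, Antitone (fun k => (P k).1 j) :=
    fun j => antitone_nat_of_succ_le (fun k => hP1 k j)
  have hstab : ∀ j d, (P (j + 1 + d)).1 j = (P (j+1)).1 j := by
    intro j d
    induction d with
    | zero => rfl
    | succ d ih => rw [← ih]; exact hP2 (j + 1 + d) j (by omega)
  refine ⟨fun j => (P (j+1)).1 j, fun j => (P (j+1)).2.sub j,
    fun j => (P (j+1)).2.card j (by omega), ?_⟩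
  rw [Set.infinite_iff_exists_gt]
  intro a
  obtain ⟨n, hn, hh⟩ := hP3 (a+1)
  refine ⟨n, ⟨e, hh.mono ?_⟩, by omega⟩
  intro j
  rcases le_total j (a + 1) with h | h
  · obtain ⟨d, hd⟩ := Nat.exists_eq_add_of_le (Nat.add_le_add_right h 1)
    rw [hd, hstab]
  · exact hanti j (Nat.add_le_add_right h 1)

def E (ρ : ℕ → ℕ) (j : ℕ) : ℕ → ℕ
  | 0 => 1
  | d + 1 => E ρ j d ^ (2 ^ ρ (j - d)) + 1

def nxt (ρ : ℕ → ℕ) (j a : ℕ) : ℕ :=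
  a * (2 ^ (∏ i ∈ Finset.range j, ρ i)) ^ ((E ρ j (j+1)) ^ 2)

def Pr (m : ℕ → ℕ) : ℕ → ℕ → ℕ
  | 0 => fun _ => 1
  | j + 1 => Function.update (Pr m j) j (nxt (Pr m j) j (m j))

theorem Pr_congr (m m' : ℕ → ℕ) (j : ℕ) (h : ∀ i, i < j → m i = m' i) : Pr m j = Pr m' j := by
  induction j with
  | zero => rfl
  | succ j ih => simp only [Pr]; rw [ih (fun i hi => h i (by omega)), h j (by omega)]

theorem Pr_stab (m : ℕ → ℕ) (i d : ℕ) : Pr m (i + 1 + d) i = Pr m (i+1) i := by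
  induction d with
  | zero => rfl
  | succ d ih =>
    rw [← ih, ← Nat.add_assoc, Pr, Function.update_of_ne (by omega)]

theorem E_pos (ρ : ℕ → ℕ) (j d : ℕ) : 1 ≤ E ρ j d := by
  cases d <;> simp [E]

end PT

theorem stmt1 :
    ∃ R : List ℕ → ℕ, (∀ s, 1 ≤ R s) ∧
      ∀ m : ℕ → ℕ, (∀ j, 1 ≤ m j) →
      ∀ c : ℕ → (ℕ → ℕ) → Bool,
        ∃ H : ℕ → Finset ℕ,
          (∀ j, H j ⊆ Finset.range (R ((List.range (j + 1)).map m))) ∧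
          (∀ j, (H j).card = m j) ∧
          {n : ℕ | ∃ ε : Bool, ∀ x : ℕ → ℕ,
              (∀ j, j ≤ n → x j ∈ H j) → (∀ j, n < j → x j = 0) →
              c n x = ε}.Infinite := by
  refine ⟨fun l => max 1 (PT.Pr (fun i => l.getD i 0) l.length (l.length - 1)),
    fun s => le_max_left _ _, ?_⟩
  intro m hm c
  have hlt : ∀ i j, i < j → PT.Pr m j i = PT.Pr m (i+1) i := by
    intro i j hij
    obtain ⟨d, rfl⟩ := Nat.exists_eq_add_of_le (Nat.succ_le_of_lt hij)
    exact PT.Pr_stab m i d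
  obtain ⟨H, h1, h2, h3⟩ := PT.core m (fun j => 2 ^ (∏ i ∈ Finset.range j, PT.Pr m (i+1) i))
    (fun j => PT.Pr m (j+1) j) (fun k j => PT.E (PT.Pr m j) j (j + 1 - k)) hm (fun _ => rfl)
    (fun k j => PT.E_pos _ _ _)
    (by
      intro k j hkj
      (try dsimp only)
      obtain ⟨d, rfl⟩ := Nat.exists_eq_add_of_le hkj
      have e1 : k + d + 1 - (k + 1) = d := by omega
      have e2 : k + d + 1 - k = d + 1 := by omega
      rw [e1, e2, PT.E, Nat.add_sub_cancel]
      cases d with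
      | zero => simp [PT.E]
      | succ d => rw [hlt k (k + (d + 1)) (by omega)])
    (by
      intro j
      (try dsimp only)
      have e : ∏ i ∈ Finset.range j, PT.Pr m (i+1) i = ∏ i ∈ Finset.range j, PT.Pr m j i :=
        Finset.prod_congr rfl (fun i hi => (hlt i j (Finset.mem_range.mp hi)).symm)
      rw [e, PT.Pr, Function.update_self, PT.nxt, Nat.sub_zero])
    c
  refine ⟨H, fun j => (h1 j).trans ?_, h2, h3⟩
  apply Finset.range_subset_range.mpr
  refine le_trans (le_of_eq ?_) (le_max_right _ _)
  rw [List.length_map, List.length_range, Nat.add_sub_cancel]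
  refine congrFun (PT.Pr_congr _ _ _ ?_) j
  intro i hi
  simp [List.getD, hi]
end

section
/- Given k ≥ 1, there is a function R_k : [ℕ⁺]^{<ω} → ℕ⁺ such that for each sequence (m_j)_{j<ω} of positive integers and each coloring c : ⋃_{n<ω} ([R_k(m_0)]^k × ∏_{j=1}^n R_k(m_0, …, m_j)) → 2, there are subsets H_j ⊆ R_k(m_0, …, m_j) with |H_j| = m_j such that c is constant on [H_0]^k × ∏_{j=1}^n H_j for infinitely many n. -/
open MeasureTheory

theorem ub {α} (U : Ultrafilter α) (f : α → Bool) : ∃ b, ∀ᶠ x in (U : Filter α), f x = b := by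
  by_cases h : ∀ᶠ x in (U : Filter α), f x = true
  · exact ⟨true, h⟩
  · refine ⟨false, ?_⟩
    rw [← Ultrafilter.eventually_not] at h
    filter_upwards [h] with x hx
    simpa using hx

theorem ramsey_inf (k m : ℕ) (c : Finset ℕ → Bool) :
    ∃ ε, ∃ H : Finset ℕ, H.card = m ∧ ∀ A ⊆ H, A.card = k → c A = ε := by
  let U : Ultrafilter ℕ := Filter.hyperfilter ℕ
  choose lim hlim using ub U
  let d : ℕ → Finset ℕ → Bool := fun i => Nat.rec c (fun _ g A => lim (fun x => g (insert x A))) i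
  have hd : ∀ i A, ∀ᶠ x in (U : Filter ℕ), d i (insert x A) = d (i+1) A := fun i A =>
    hlim (fun x => d i (insert x A))
  have key : ∃ H : Finset ℕ, H.card = m ∧ ∀ A ⊆ H, A.card ≤ k → d (k - A.card) A = d k ∅ := by
    induction m with
    | zero =>
      refine ⟨∅, rfl, fun A hA _ => ?_⟩
      rw [Finset.subset_empty.1 hA]; simp
    | succ m ih =>
      obtain ⟨H, hc, hH⟩ := ih
      have h1 : ∀ᶠ x in (U : Filter ℕ), ∀ A ∈ H.powerset, A.card < k →
          d (k - A.card - 1) (insert x A) = d (k - A.card) A := by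
        rw [Filter.eventually_all_finset]
        intro A hA
        by_cases h : A.card < k
        · have := hd (k - A.card - 1) A
          have e : k - A.card - 1 + 1 = k - A.card := by omega
          rw [e] at this
          filter_upwards [this] with x hx _ using hx
        · exact Filter.Eventually.of_forall fun x h' => absurd h' h
      have h2 : ∀ᶠ x in (U : Filter ℕ), x ∉ H := by
        have : (H : Set ℕ)ᶜ ∈ Filter.hyperfilter ℕ := Set.Finite.compl_mem_hyperfilter H.finite_toSet
        exact this
      obtain ⟨x, hx1, hx2⟩ := (h1.and h2).exists
      refine ⟨insert x H, by rw [Finset.card_insert_of_notMem hx2, hc], fun A hA hAk => ?_⟩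
      by_cases hxA : x ∈ A
      · have hB : A.erase x ⊆ H := by
          rwa [← Finset.subset_insert_iff]
        have hcard := Finset.card_erase_add_one hxA
        have h3 := hx1 (A.erase x) (Finset.mem_powerset.2 hB) (by omega)
        rw [Finset.insert_erase hxA] at h3
        have e : k - (A.erase x).card - 1 = k - A.card := by omega
        rw [e] at h3
        rw [h3]
        exact hH _ hB (by omega)
      · exact hH A ((Finset.subset_insert_iff_of_notMem hxA).1 hA) hAk
  obtain ⟨H, hc, hH⟩ := key
  refine ⟨d k ∅, H, hc, fun A hA hk => ?_⟩
  have := hH A hA hk.le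
  rw [hk, Nat.sub_self] at this
  exact this

theorem ramsey_fin (k m : ℕ) : ∃ N : ℕ, 1 ≤ N ∧ ∀ c : Finset ℕ → Bool,
    ∃ ε, ∃ H : Finset ℕ, H ⊆ Finset.range N ∧ H.card = m ∧ ∀ A ⊆ H, A.card = k → c A = ε := by
  by_contra hcon
  push Not at hcon
  have h1 : ∀ N : ℕ, ∃ c : Finset ℕ → Bool, 1 ≤ N → ∀ ε, ∀ H : Finset ℕ, H ⊆ Finset.range N →
      H.card = m → ∃ A ⊆ H, A.card = k ∧ c A ≠ ε := by
    intro N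
    by_cases hN : 1 ≤ N
    · obtain ⟨c, hc⟩ := hcon N hN
      exact ⟨c, fun _ => hc⟩
    · exact ⟨fun _ => true, fun h => absurd h hN⟩
  choose c hc using h1
  let U : Ultrafilter ℕ := Filter.hyperfilter ℕ
  choose e he using fun A => ub U (fun N => c N A)
  obtain ⟨ε, H, hcard, hH⟩ := ramsey_inf k m e
  have h2 : ∀ᶠ N in (U : Filter ℕ), ∀ A ∈ H.powerset, c N A = e A := by
    rw [Filter.eventually_all_finset]
    exact fun A _ => he A
  have h3 : ∀ᶠ N in (U : Filter ℕ), H.sup id + 1 ≤ N := by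
    have : ∀ᶠ N in Filter.atTop, H.sup id + 1 ≤ N := Filter.eventually_ge_atTop _
    rw [← Nat.cofinite_eq_atTop] at this
    exact Filter.hyperfilter_le_cofinite this
  obtain ⟨N, hN1, hN2⟩ := (h2.and h3).exists
  obtain ⟨A, hA, hAk, hne⟩ := hc N (by omega) ε H (fun x hx => by
    have : x ≤ H.sup id := Finset.le_sup (f := id) hx
    simp; omega) hcard
  exact hne ((hN1 A (Finset.mem_powerset.2 hA)).trans (hH A hA hAk))

theorem inf_pigeon {τ : Type*} (A : Set ℕ) (hA : A.Infinite) (T : Finset τ) (P : ℕ → τ → Prop)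
    (h : ∀ n ∈ A, ∃ t ∈ T, P n t) : ∃ t ∈ T, {n | n ∈ A ∧ P n t}.Infinite := by
  by_contra hcon
  push Not at hcon
  apply hA
  refine (T.finite_toSet.biUnion (t := fun t => {n | n ∈ A ∧ P n t}) ?_).subset ?_
  · intro t ht
    exact hcon t ht
  · intro n hn
    obtain ⟨t, ht, hp⟩ := h n hn
    simp only [Set.mem_iUnion]
    exact ⟨t, ht, hn, hp⟩

theorem exists_inter {X ι : Type*} [DecidableEq ι] [MeasurableSpace X] (μ : Measure X) [IsProbabilityMeasure μ]
    (E : ι → Set X) (hE : ∀ a, MeasurableSet (E a)) (s : Finset ι) (m q : ℕ) (hq : 1 ≤ q)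
    (hm : 1 ≤ m)
    (hs : s.card = 2 * m * q) (h : (s.card : ℝ) / q ≤ ∑ a ∈ s, μ.real (E a)) :
    ∃ H ⊆ s, H.card = m ∧ 1 / ((q * 2 ^ (s.card + 1) : ℕ) : ℝ) ≤ μ.real {x | ∀ a ∈ H, x ∈ E a} := by
  classical
  by_contra hcon
  push Not at hcon
  let I : Finset ι → Set X := fun H => {x | ∀ a ∈ H, x ∈ E a}
  have hI : ∀ H, MeasurableSet (I H) := by
    intro H
    have : I H = ⋂ a ∈ H, E a := by ext; simp [I]
    rw [this]
    exact Finset.measurableSet_biInter _ fun a _ => hE a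
  have hpt : ∀ x, ∑ a ∈ s, (E a).indicator (1 : X → ℝ) x ≤
      m + s.card * ∑ H ∈ s.powersetCard m, (I H).indicator (1 : X → ℝ) x := by
    intro x
    have e1 : ∑ a ∈ s, (E a).indicator (1 : X → ℝ) x = ((s.filter (fun a => x ∈ E a)).card : ℝ) := by
      simp [Set.indicator_apply]
    rw [e1]
    have hnn : ∀ H ∈ s.powersetCard m, 0 ≤ (I H).indicator (1 : X → ℝ) x := fun H _ =>
      Set.indicator_nonneg (fun _ _ => zero_le_one) x
    by_cases hc : (s.filter (fun a => x ∈ E a)).card ≤ m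
    · have : ((s.filter (fun a => x ∈ E a)).card : ℝ) ≤ m := by exact_mod_cast hc
      have := Finset.sum_nonneg hnn
      have : 0 ≤ s.card * ∑ H ∈ s.powersetCard m, (I H).indicator (1 : X → ℝ) x := by positivity
      linarith
    · obtain ⟨H, hH, hHc⟩ := Finset.exists_subset_card_eq (not_le.1 hc).le
      have h1 : (I H).indicator (1 : X → ℝ) x = 1 := by
        rw [Set.indicator_of_mem]; · rfl
        intro a ha
        exact (Finset.mem_filter.1 (hH ha)).2
      have h2 : 1 ≤ ∑ H ∈ s.powersetCard m, (I H).indicator (1 : X → ℝ) x := by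
        rw [← h1]
        exact Finset.single_le_sum hnn (Finset.mem_powersetCard.2 ⟨hH.trans (Finset.filter_subset _ _), hHc⟩)
      have h3 : ((s.filter (fun a => x ∈ E a)).card : ℝ) ≤ s.card := by
        exact_mod_cast Finset.card_filter_le _ _
      have : (s.card : ℝ) * 1 ≤ s.card * ∑ H ∈ s.powersetCard m, (I H).indicator (1 : X → ℝ) x := by
        gcongr
      have : (0:ℝ) ≤ m := by positivity
      linarith
  have hint : ∀ S : Set X, MeasurableSet S → Integrable (S.indicator (1 : X → ℝ)) μ := fun S hS =>
    (integrable_const (1:ℝ)).indicator hS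
  have hI2 := integral_mono (μ := μ) (integrable_finsetSum s fun a _ => hint _ (hE a))
    ((integrable_const (m:ℝ)).add ((integrable_finsetSum (s.powersetCard m) fun H _ => hint _ (hI H)).const_mul (s.card:ℝ)))
    (by intro x; simpa using hpt x)
  rw [integral_finsetSum _ (fun a _ => hint _ (hE a))] at hI2
  simp only [Pi.add_apply] at hI2
  rw [integral_add (integrable_const _) ((integrable_finsetSum (s.powersetCard m) fun H _ => hint _ (hI H)).const_mul (s.card:ℝ)),
    integral_const_mul, integral_finsetSum _ (fun a _ => hint _ (hI a))] at hI2
  simp only [integral_indicator_one (hE _), integral_indicator_one (hI _), integral_const, probReal_univ, one_smul] at hI2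
  have hq' : (1:ℝ) ≤ q := by exact_mod_cast hq
  have hm' : (1:ℝ) ≤ m := by exact_mod_cast hm
  have hsr : (s.card : ℝ) = 2 * m * q := by exact_mod_cast hs
  have hlt : ∑ H ∈ s.powersetCard m, μ.real (I H) < 1 / (2 * q) := by
    have hne : (s.powersetCard m).Nonempty := by
      apply Finset.powersetCard_nonempty_of_le
      rw [hs]; nlinarith
    calc _ < ∑ H ∈ s.powersetCard m, 1 / ((q * 2 ^ (s.card + 1) : ℕ) : ℝ) := by
          apply Finset.sum_lt_sum_of_nonempty hne
          intro H hH
          obtain ⟨a, b⟩ := Finset.mem_powersetCard.1 hH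
          exact hcon H a b
      _ = ((s.powersetCard m).card : ℝ) * (1 / ((q * 2 ^ (s.card + 1) : ℕ) : ℝ)) := by
          rw [Finset.sum_const, nsmul_eq_mul]
      _ ≤ (2 ^ s.card : ℝ) * (1 / ((q * 2 ^ (s.card + 1) : ℕ) : ℝ)) := by
          gcongr
          rw [Finset.card_powersetCard]
          exact_mod_cast Nat.choose_le_two_pow _ _
      _ = _ := by
          push_cast
          field_simp
          ring
  have : (s.card : ℝ) * ∑ H ∈ s.powersetCard m, μ.real (I H) < s.card * (1 / (2 * q)) := by
    apply mul_lt_mul_of_pos_left hlt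
    rw [hsr]; positivity
  have e2 : (s.card:ℝ) * (1/(2*q)) = m := by rw [hsr]; field_simp
  have e3 : (s.card:ℝ) / q = 2 * m := by rw [hsr]; field_simp
  linarith

theorem exists_pair {X : Type*} [MeasurableSpace X] (μ : Measure X) [IsProbabilityMeasure μ]
    (E : ℕ → Set X) (hE : ∀ a, MeasurableSet (E a)) (A : Set ℕ) (hA : A.Infinite) (q : ℕ) (hq : 1 ≤ q)
    (h : ∀ n ∈ A, 1 / (q : ℝ) ≤ μ.real (E n)) :
    ∃ p ∈ A, {n | n ∈ A ∧ p < n ∧ 1 / ((q * 2 ^ (4 * q + 1) : ℕ) : ℝ) ≤ μ.real (E p ∩ E n)}.Infinite := by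
  by_contra hcon
  push Not at hcon
  obtain ⟨f, hf1, hf2⟩ := exists_seq_of_forall_finset_exists (fun n => n ∈ A)
    (fun p n => p < n ∧ ¬ (1 / ((q * 2 ^ (4 * q + 1) : ℕ) : ℝ) ≤ μ.real (E p ∩ E n))) (by
      intro s hs
      have hfin : (Set.Iic (s.sup id) ∪ ⋃ p ∈ s, {n | n ∈ A ∧ p < n ∧ 1 / ((q * 2 ^ (4 * q + 1) : ℕ) : ℝ) ≤ μ.real (E p ∩ E n)}).Finite :=
        (Set.finite_Iic _).union (s.finite_toSet.biUnion fun p hp => hcon p (hs p hp))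
      obtain ⟨n, hnA, hn⟩ := hA.exists_notMem_finite hfin
      refine ⟨n, hnA, fun p hp => ?_⟩
      simp only [Set.mem_union, Set.mem_Iic, Set.mem_iUnion, not_or, not_exists, Set.mem_ofPred_eq] at hn
      have hpn : p < n := (Finset.le_sup (f := id) hp).trans_lt (not_le.1 hn.1)
      exact ⟨hpn, fun h' => hn.2 p hp ⟨hnA, hpn, h'⟩⟩)
  obtain ⟨H, -, hc, hH⟩ := exists_inter μ (fun i => E (f i)) (fun i => hE _) (Finset.range (4*q)) 2 q hq
    (by norm_num) (by simp) (by
      calc _ = ∑ i ∈ Finset.range (4*q), 1 / (q:ℝ) := by simp [div_eq_mul_inv]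
        _ ≤ _ := Finset.sum_le_sum fun i _ => h _ (hf1 i))
  obtain ⟨a, b, hab, rfl⟩ := Finset.card_eq_two.1 hc
  rw [Finset.card_range] at hH
  have e : {x | ∀ i ∈ ({a, b} : Finset ℕ), x ∈ E (f i)} = E (f a) ∩ E (f b) := by
    ext; simp
  rw [e] at hH
  rcases lt_or_gt_of_ne hab with h' | h'
  · exact (hf2 a b h').2 hH
  · rw [Set.inter_comm] at hH
    exact (hf2 b a h').2 hH

theorem exists_measure (N : ℕ → ℕ) (hN : ∀ j, 1 ≤ N j) :
    ∃ μ : Measure (ℕ → ℕ), IsProbabilityMeasure μ ∧ ∀ j (E : Set (ℕ → ℕ)), MeasurableSet E →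
      (N j : ℝ) * μ.real E = ∑ a ∈ Finset.range (N j), μ.real {x | Function.update x j a ∈ E} := by
  classical
  let ν : ℕ → Measure ℕ := fun j => (N j : ENNReal)⁻¹ • ∑ a ∈ Finset.range (N j), Measure.dirac a
  have hN0 : ∀ j, (N j : ENNReal) ≠ 0 := fun j => by
    have := hN j
    simp; omega
  have hνa : ∀ j (t : Set ℕ), ν j t = (N j : ENNReal)⁻¹ * ∑ a ∈ Finset.range (N j), t.indicator 1 a := by
    intro j t
    simp [ν, Measure.finsetSum_apply]
  have hν : ∀ j, IsProbabilityMeasure (ν j) := fun j => ⟨by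
    rw [hνa]
    simp [ENNReal.inv_mul_cancel (hN0 j)]⟩
  refine ⟨Measure.infinitePi ν, inferInstance, fun j E hE => ?_⟩
  set μ := Measure.infinitePi ν with hμ
  have hup : ∀ a, Measurable (fun x : ℕ → ℕ => Function.update x j a) := fun a => measurable_update_left
  have key : (N j : ENNReal)⁻¹ • ∑ a ∈ Finset.range (N j), μ.map (fun x => Function.update x j a) = μ := by
    apply Measure.eq_infinitePi
    intro s t ht
    have hbox : MeasurableSet ((s : Set ℕ).pi t) := MeasurableSet.pi s.countable_toSet fun i _ => ht i
    rw [Measure.smul_apply, Measure.finsetSum_apply]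
    simp only [Measure.map_apply (hup _) hbox, smul_eq_mul]
    by_cases hj : j ∈ s
    · have e : ∀ a, (fun x : ℕ → ℕ => Function.update x j a) ⁻¹' ((s : Set ℕ).pi t) =
          if a ∈ t j then (((s.erase j : Finset ℕ)) : Set ℕ).pi t else ∅ := by
        intro a
        ext x
        split_ifs with ha
        · simp only [Set.mem_preimage, Set.mem_pi, Finset.mem_coe, Finset.mem_erase]
          constructor
          · rintro h i ⟨hi, his⟩
            simpa [hi] using h i his
          · intro h i his
            by_cases hi : i = j
            · subst hi; simpa using ha
            · simpa [hi] using h i ⟨hi, his⟩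
        · simp only [Set.mem_preimage, Set.mem_pi, Finset.mem_coe, Set.mem_empty_iff_false, iff_false]
          intro h
          exact ha (by simpa using h j hj)
      have e2 : ∀ a, μ ((fun x : ℕ → ℕ => Function.update x j a) ⁻¹' ((s : Set ℕ).pi t)) =
          (t j).indicator 1 a * ∏ i ∈ s.erase j, ν i (t i) := by
        intro a
        rw [e a]
        split_ifs with ha
        · rw [hμ, Measure.infinitePi_pi _ fun i _ => ht i]; simp [ha]
        · simp [ha]
      simp only [e2]
      rw [← Finset.sum_mul, ← mul_assoc, ← hνa, Finset.mul_prod_erase s (fun i => ν i (t i)) hj]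
    · have e : ∀ a, (fun x : ℕ → ℕ => Function.update x j a) ⁻¹' ((s : Set ℕ).pi t) = (s : Set ℕ).pi t := by
        intro a
        ext x
        simp only [Set.mem_preimage, Set.mem_pi, Finset.mem_coe]
        refine forall_congr' fun i => forall_congr' fun hi => ?_
        have : i ≠ j := fun h => hj (h ▸ hi)
        simp [this]
      simp only [e]
      rw [hμ, Measure.infinitePi_pi _ fun i _ => ht i]
      simp only [Finset.sum_const, Finset.card_range, nsmul_eq_mul]
      rw [← mul_assoc, ENNReal.inv_mul_cancel (hN0 j) (by simp), one_mul]
  have h1 : μ E = (N j : ENNReal)⁻¹ * ∑ a ∈ Finset.range (N j), μ {x | Function.update x j a ∈ E} := by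
    conv_lhs => rw [← key]
    rw [Measure.smul_apply, Measure.finsetSum_apply]
    simp only [Measure.map_apply (hup _) hE, smul_eq_mul]
    rfl
  have h2 : (N j : ENNReal) * μ E = ∑ a ∈ Finset.range (N j), μ {x | Function.update x j a ∈ E} := by
    rw [h1, ← mul_assoc, ENNReal.mul_inv_cancel (hN0 j) (by simp), one_mul]
  have h3 := congrArg ENNReal.toReal h2
  rw [ENNReal.toReal_mul, ENNReal.toReal_sum (fun a _ => measure_ne_top _ _)] at h3
  simpa [Measure.real] using h3

/-- Sets determined by the coordinates up to `n`. -/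
def Dtm (n : ℕ) (E : Set (ℕ → ℕ)) : Prop :=
  ∀ z w : ℕ → ℕ, (∀ i ≤ n, z i = w i) → z ∈ E → w ∈ E

theorem Dtm.meas {n : ℕ} {E : Set (ℕ → ℕ)} (h : Dtm n E) : MeasurableSet E := by
  let r : (ℕ → ℕ) → (Fin (n+1) → ℕ) := fun z i => z i
  have hr : Measurable r := measurable_pi_lambda _ fun i => measurable_pi_apply _
  have : E = r ⁻¹' (r '' E) := by
    ext z
    constructor
    · intro hz; exact ⟨z, hz, rfl⟩
    · rintro ⟨w, hw, e⟩
      refine h w z (fun i hi => ?_) hw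
      exact congrFun e ⟨i, by omega⟩
  rw [this]
  exact hr (Set.to_countable _).measurableSet

/-- Fibre sets: coordinates `1..j` ranging over `H`. -/
def GG (D : ℕ → Set (ℕ → ℕ)) (j : ℕ) (H : ℕ → Finset ℕ) (n : ℕ) : Set (ℕ → ℕ) :=
  {z | ∀ x : ℕ → ℕ, (∀ i, 1 ≤ i → i ≤ j → x i ∈ H i) → (fun i => if i ≤ j then x i else z i) ∈ D n}

theorem GG_dtm {D : ℕ → Set (ℕ → ℕ)} (hD : ∀ n, Dtm n (D n)) (j H n) : Dtm n (GG D j H n) := by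
  intro z w h hz x hx
  refine hD n _ _ (fun i hi => ?_) (hz x hx)
  simp only [h i hi]

theorem GG_succ {D : ℕ → Set (ℕ → ℕ)} (j : ℕ) (H : ℕ → Finset ℕ) (K : Finset ℕ) (n : ℕ) :
    GG D (j+1) (Function.update H (j+1) K) n = {z | ∀ a ∈ K, Function.update z (j+1) a ∈ GG D j H n} := by
  ext z
  constructor
  · intro hz a ha x hx
    have := hz (Function.update x (j+1) a) (by
      intro i h1 h2
      by_cases hi : i = j+1
      · subst hi; simpa using ha
      · simpa [hi] using hx i h1 (by omega))
    convert this using 2 with i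
    by_cases hi : i = j+1
    · subst hi; simp
    · have : i ≤ j + 1 ↔ i ≤ j := by omega
      simp [hi, this]
  · intro hz x hx
    have h0 := hx (j+1) (by omega) le_rfl
    simp only [Function.update_self] at h0
    have := hz _ h0 x (by
      intro i h1 h2
      have := hx i h1 (by omega)
      rwa [Function.update_of_ne (by omega)] at this)
    convert this using 2 with i
    by_cases hi : i = j+1
    · subst hi; simp
    · have : i ≤ j + 1 ↔ i ≤ j := by omega
      simp [hi, this]

def StInv (μ : Measure (ℕ → ℕ)) (D : ℕ → Set (ℕ → ℕ)) (q : ℕ) (j : ℕ)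
    (s : (ℕ → Finset ℕ) × Finset ℕ × Set ℕ) : Prop :=
  s.2.1.card = j ∧ s.2.2.Infinite ∧ (∀ n ∈ s.2.2, ∀ p ∈ s.2.1, p < n) ∧
  ∀ n ∈ s.2.2, 1 / (q : ℝ) ≤ μ.real (GG D j s.1 n ∩ {z | ∀ p ∈ s.2.1, z ∈ GG D j s.1 p})

def qstep (q m : ℕ) : ℕ :=
  (q * 2 ^ (2 * m * q + 1)) * 2 ^ (4 * (q * 2 ^ (2 * m * q + 1)) + 1)

theorem inv_step (μ : Measure (ℕ → ℕ)) [IsProbabilityMeasure μ] (D : ℕ → Set (ℕ → ℕ))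
    (hD : ∀ n, Dtm n (D n)) (q m j : ℕ) (hq : 1 ≤ q) (hm : 1 ≤ m)
    (hμ : ∀ (E : Set (ℕ → ℕ)), MeasurableSet E → ((2 * m * q : ℕ) : ℝ) * μ.real E =
      ∑ a ∈ Finset.range (2 * m * q), μ.real {x | Function.update x (j+1) a ∈ E})
    (s : (ℕ → Finset ℕ) × Finset ℕ × Set ℕ) (hs : StInv μ D q j s) :
    ∃ s', StInv μ D (qstep q m) (j+1) s' ∧ s.2.1 ⊆ s'.2.1 ∧ ∃ K : Finset ℕ,
      K ⊆ Finset.range (2 * m * q) ∧ K.card = m ∧ s'.1 = Function.update s.1 (j+1) K := by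
  obtain ⟨H, F, A⟩ := s
  obtain ⟨hF, hA, hlt, hmu⟩ := hs
  simp only at hF hA hlt hmu
  have hG : ∀ j H n, MeasurableSet (GG D j H n) := fun j H n => (GG_dtm hD j H n).meas
  have hE : ∀ j H n, MeasurableSet (GG D j H n ∩ {z | ∀ p ∈ F, z ∈ GG D j H p}) := by
    intro j H n
    refine (hG j H n).inter ?_
    have : {z | ∀ p ∈ F, z ∈ GG D j H p} = ⋂ p ∈ F, GG D j H p := by ext; simp
    rw [this]
    exact Finset.measurableSet_biInter _ fun p _ => hG j H p
  have h1 : ∀ n ∈ A, ∃ K ∈ (Finset.range (2*m*q)).powersetCard m,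
      1 / ((q * 2 ^ (2*m*q + 1) : ℕ) : ℝ) ≤
        μ.real (GG D (j+1) (Function.update H (j+1) K) n ∩
          {z | ∀ p ∈ F, z ∈ GG D (j+1) (Function.update H (j+1) K) p}) := by
    intro n hn
    obtain ⟨K, hK, hc, hb⟩ := exists_inter μ
      (fun a => {x | Function.update x (j+1) a ∈ GG D j H n ∩ {z | ∀ p ∈ F, z ∈ GG D j H p}})
      (fun a => measurable_update_left (hE j H n))
      (Finset.range (2*m*q)) m q hq hm (by simp) (by
        rw [← hμ _ (hE j H n), Finset.card_range, div_eq_mul_one_div]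
        gcongr
        exact hmu n hn)
    refine ⟨K, Finset.mem_powersetCard.2 ⟨hK, hc⟩, ?_⟩
    rw [Finset.card_range] at hb
    convert hb using 2
    simp only [GG_succ]
    ext z
    simp only [Set.mem_inter_iff, Set.mem_ofPred_eq]
    constructor
    · rintro ⟨u, v⟩ a ha
      exact ⟨u a ha, fun p hp => v p hp a ha⟩
    · intro u
      exact ⟨fun a ha => (u a ha).1, fun p hp a ha => (u a ha).2 p hp⟩
  obtain ⟨K, hK, hinf⟩ := inf_pigeon A hA _ _ h1
  obtain ⟨hK1, hK2⟩ := Finset.mem_powersetCard.1 hK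
  obtain ⟨p, hp, hinf2⟩ := exists_pair μ _ (hE (j+1) (Function.update H (j+1) K)) _ hinf
    (q * 2 ^ (2*m*q + 1)) (Nat.mul_pos hq (by positivity)) (fun n hn => hn.2)
  refine ⟨⟨Function.update H (j+1) K, insert p F, _⟩, ⟨?_, hinf2, ?_, ?_⟩, Finset.subset_insert _ _,
    K, hK1, hK2, rfl⟩
  · have : p ∉ F := fun h => lt_irrefl _ (hlt p hp.1 p h)
    simp only [Finset.card_insert_of_notMem this, hF]
  · rintro n ⟨hn, hpn, -⟩ p' hp'
    rcases Finset.mem_insert.1 hp' with rfl | h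
    · exact hpn
    · exact hlt n hn.1 p' h
  · rintro n ⟨hn, hpn, hb⟩
    refine hb.trans (measureReal_mono ?_ (measure_ne_top _ _))
    rintro z ⟨⟨a1, a2⟩, b1, b2⟩
    refine ⟨b1, fun p' hp' => ?_⟩
    rcases Finset.mem_insert.1 hp' with rfl | h
    · exact a1
    · exact a2 p' h

noncomputable def Ram (k m : ℕ) : ℕ := (ramsey_fin k m).choose

noncomputable def qf (k : ℕ) (m : ℕ → ℕ) : ℕ → ℕ
  | 0 => 2 ^ (Ram k (m 0) + 1)
  | j+1 => qstep (qf k m j) (m (j+1))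

noncomputable def Rf (k : ℕ) (m : ℕ → ℕ) : ℕ → ℕ
  | 0 => Ram k (m 0)
  | j+1 => 2 * m (j+1) * qf k m j

theorem qf_pos (k m j) : 1 ≤ qf k m j := by
  cases j with
  | zero => exact Nat.one_le_two_pow
  | succ j =>
    induction j with
    | zero => simp only [qf, qstep]; exact Nat.succ_le_of_lt (by positivity)
    | succ j ih =>
      rw [qf]; unfold qstep
      exact Nat.succ_le_of_lt (by positivity)

theorem qf_congr (k : ℕ) (m m' : ℕ → ℕ) (j : ℕ) (h : ∀ i ≤ j, m i = m' i) : qf k m j = qf k m' j := by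
  induction j with
  | zero => simp [qf, h 0 le_rfl]
  | succ j ih => rw [qf, qf, ih fun i hi => h i (by omega), h _ le_rfl]

theorem Rf_congr (k : ℕ) (m m' : ℕ → ℕ) (j : ℕ) (h : ∀ i ≤ j, m i = m' i) : Rf k m j = Rf k m' j := by
  cases j with
  | zero => simp [Rf, h 0 le_rfl]
  | succ j => rw [Rf, Rf, qf_congr k m m' j fun i hi => h i (by omega), h _ le_rfl]

theorem Rf_pos (k : ℕ) (m : ℕ → ℕ) (hm : ∀ j, 1 ≤ m j) (j : ℕ) : 1 ≤ Rf k m j := by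
  cases j with
  | zero => exact (ramsey_fin k (m 0)).choose_spec.1
  | succ j =>
    have := qf_pos k m j
    have := hm (j+1)
    rw [Rf]
    exact Nat.succ_le_of_lt (by positivity)

/-- Truncation to coordinates `1..n`. -/
def tr (n : ℕ) (z : ℕ → ℕ) : ℕ → ℕ := fun j => if 1 ≤ j ∧ j ≤ n then z j else 0

theorem main_aux (k : ℕ) (m : ℕ → ℕ) (hm : ∀ j, 1 ≤ m j) (c : ℕ → Finset ℕ → (ℕ → ℕ) → Bool) :
    ∃ H : ℕ → Finset ℕ, (∀ j, H j ⊆ Finset.range (Rf k m j)) ∧ (∀ j, (H j).card = m j) ∧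
      {n : ℕ | ∃ ε : Bool, ∀ A : Finset ℕ, A ⊆ H 0 → A.card = k →
              ∀ x : ℕ → ℕ, (∀ j, 1 ≤ j → j ≤ n → x j ∈ H j) →
                x 0 = 0 → (∀ j, n < j → x j = 0) →
                c n A x = ε}.Infinite := by
  obtain ⟨μ, hμp, hμ⟩ := exists_measure (Rf k m) (Rf_pos k m hm)
  have hRam := (ramsey_fin k (m 0)).choose_spec.2
  set N := Ram k (m 0) with hN
  change ∀ c : Finset ℕ → Bool, ∃ ε, ∃ H : Finset ℕ, H ⊆ Finset.range N ∧ H.card = m 0 ∧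
    ∀ A ⊆ H, A.card = k → c A = ε at hRam
  let DD : Finset ℕ × Bool → ℕ → Set (ℕ → ℕ) := fun t n =>
    {z | ∀ A ⊆ t.1, A.card = k → c n A (tr n z) = t.2}
  let T : Finset (Finset ℕ × Bool) := (Finset.range N).powersetCard (m 0) ×ˢ Finset.univ
  have hTc : T.card ≤ 2 ^ (N + 1) := by
    simp only [T, Finset.card_product, Finset.card_powersetCard, Finset.card_range, Finset.card_univ,
      Fintype.card_bool]
    rw [pow_succ]
    exact Nat.mul_le_mul_right _ (Nat.choose_le_two_pow _ _)
  have h0 : ∀ n ∈ (Set.univ : Set ℕ), ∃ t ∈ T, 1 / ((2 ^ (N+1) : ℕ) : ℝ) ≤ μ.real (DD t n) := by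
    intro n _
    by_contra hcon
    push Not at hcon
    have hcov : (Set.univ : Set (ℕ → ℕ)) ⊆ ⋃ t ∈ T, DD t n := by
      intro z _
      obtain ⟨ε, H, h1, h2, h3⟩ := hRam (fun A => c n A (tr n z))
      simp only [Set.mem_iUnion]
      exact ⟨(H, ε), by simp [T, Finset.mem_powersetCard, h1, h2], h3⟩
    have h1 : (1:ℝ) ≤ ∑ t ∈ T, μ.real (DD t n) := by
      rw [← probReal_univ (μ := μ)]
      exact (measureReal_mono hcov (measure_ne_top _ _)).trans (measureReal_biUnion_finset_le _ _)
    have hne : T.Nonempty := by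
      by_contra h
      rw [Finset.not_nonempty_iff_eq_empty] at h
      rw [h] at h1
      norm_num at h1
    have h2 : ∑ t ∈ T, μ.real (DD t n) < ∑ t ∈ T, 1 / ((2 ^ (N+1) : ℕ) : ℝ) :=
      Finset.sum_lt_sum_of_nonempty hne hcon
    rw [Finset.sum_const, nsmul_eq_mul, mul_one_div] at h2
    have h3 : (T.card : ℝ) / ((2 ^ (N+1) : ℕ) : ℝ) ≤ 1 := by
      apply div_le_one_of_le₀ _ (by positivity)
      exact_mod_cast hTc
    linarith
  obtain ⟨⟨H0, ε⟩, ht, hinf⟩ := inf_pigeon Set.univ Set.infinite_univ T _ h0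
  have hH0 : H0 ⊆ Finset.range N ∧ H0.card = m 0 := by
    simpa [T, Finset.mem_powersetCard] using ht
  set D := DD (H0, ε) with hDdef
  have hD : ∀ n, Dtm n (D n) := by
    intro n z w h hz A hA hk
    have : tr n w = tr n z := by
      funext i
      unfold tr
      split_ifs with hi
      · exact (h i hi.2).symm
      · rfl
    rw [this]
    exact hz A hA hk
  -- build the sequence of states
  have hinit : StInv μ D (qf k m 0) 0 (fun _ => H0, ∅, {n | n ∈ Set.univ ∧ 1 / ((2 ^ (N+1) : ℕ) : ℝ) ≤ μ.real (D n)}) := by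
    refine ⟨rfl, hinf, by simp, ?_⟩
    rintro n ⟨-, hn⟩
    refine hn.trans (measureReal_mono ?_ (measure_ne_top _ _))
    intro z hz
    refine ⟨?_, by simp⟩
    intro x _ A hA hk
    have : tr n (fun i => if i ≤ 0 then x i else z i) = tr n z := by
      funext i
      unfold tr
      by_cases h : 1 ≤ i ∧ i ≤ n
      · have h' : ¬ i ≤ 0 := by omega
        simp only [h', if_false]
      · rw [if_neg h, if_neg h]
    rw [this]
    exact hz A hA hk
  have hstep : ∀ j (s : {s // StInv μ D (qf k m j) j s}), ∃ s' : {s // StInv μ D (qf k m (j+1)) (j+1) s},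
      s.1.2.1 ⊆ s'.1.2.1 ∧ ∃ K : Finset ℕ,
      K ⊆ Finset.range (Rf k m (j+1)) ∧ K.card = m (j+1) ∧ s'.1.1 = Function.update s.1.1 (j+1) K := by
    rintro j ⟨s, hs⟩
    obtain ⟨s', h1, h2, h3⟩ := inv_step μ D hD (qf k m j) (m (j+1)) j (qf_pos k m j) (hm _)
      (fun E hE => hμ (j+1) E hE) s hs
    exact ⟨⟨s', h1⟩, h2, h3⟩
  choose nxt hn1 hn2 using hstep
  let f : ∀ j, {s // StInv μ D (qf k m j) j s} := fun j => Nat.rec ⟨_, hinit⟩ (fun j s => nxt j s) j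
  have hfF : ∀ j, (f j).1.2.1 ⊆ (f (j+1)).1.2.1 := fun j => hn1 j (f j)
  have hfH : ∀ j, ∃ K : Finset ℕ, K ⊆ Finset.range (Rf k m (j+1)) ∧ K.card = m (j+1) ∧
      (f (j+1)).1.1 = Function.update (f j).1.1 (j+1) K := fun j => hn2 j (f j)
  have hFmono : Monotone fun j => (f j).1.2.1 := monotone_nat_of_le_succ hfF
  have hcoh : ∀ i J, i ≤ J → (f J).1.1 i = (f i).1.1 i := by
    intro i J hJ
    induction J, hJ using Nat.le_induction with
    | base => rfl
    | succ J hJ ih =>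
      obtain ⟨K, -, -, e⟩ := hfH J
      rw [e, Function.update_of_ne (by omega), ih]
  have hcard : ∀ j, ((f j).1.1 j).card = m j := by
    intro j
    cases j with
    | zero => exact hH0.2
    | succ j =>
      obtain ⟨K, -, h, e⟩ := hfH j
      rw [e]; simpa using h
  refine ⟨fun j => (f j).1.1 j, ?_, hcard, ?_⟩
  · intro j
    cases j with
    | zero => exact hH0.1
    | succ j =>
      obtain ⟨K, h, -, e⟩ := hfH j
      change (f (j+1)).1.1 (j+1) ⊆ _
      rw [e]; simpa using h
  have hgood : ∀ j, ∀ p ∈ (f j).1.2.1, ∀ A : Finset ℕ, A ⊆ H0 → A.card = k →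
              ∀ x : ℕ → ℕ, (∀ i, 1 ≤ i → i ≤ p → x i ∈ (f i).1.1 i) →
                x 0 = 0 → (∀ i, p < i → x i = 0) → c p A x = ε := by
    intro j p hp A hA hk x hx hx0 hxp
    have hpJ : p ∈ (f (max j p)).1.2.1 := hFmono (le_max_left j p) hp
    obtain ⟨-, hAinf, -, hpos⟩ := (f (max j p)).2
    obtain ⟨n, hn⟩ := hAinf.nonempty
    have hpos := hpos n hn
    have hne : (GG D (max j p) (f (max j p)).1.1 n ∩
        {z | ∀ p' ∈ (f (max j p)).1.2.1, z ∈ GG D (max j p) (f (max j p)).1.1 p'}).Nonempty := by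
      by_contra h
      rw [Set.not_nonempty_iff_eq_empty] at h
      rw [h] at hpos
      have hq : (1:ℝ) ≤ qf k m (max j p) := by exact_mod_cast qf_pos k m _
      have : (0:ℝ) < 1 / qf k m (max j p) := by positivity
      simp only [measureReal_empty] at hpos
      linarith
    obtain ⟨z, -, hz⟩ := hne
    have hex : ∀ i, ∃ a, a ∈ (f i).1.1 i := by
      intro i
      apply Finset.card_pos.1
      rw [hcard]; exact hm i
    choose g hg using hex
    have h1 := hz p hpJ (fun i => if i ≤ p then x i else g i) (by
      intro i hi1 hi2
      rw [hcoh i _ hi2]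
      by_cases h : i ≤ p
      · simpa [h] using hx i hi1 h
      · simpa [h] using hg i) A hA hk
    have e : tr p (fun i => if i ≤ max j p then (if i ≤ p then x i else g i) else z i) = x := by
      funext i
      unfold tr
      by_cases h : 1 ≤ i ∧ i ≤ p
      · have : i ≤ max j p := h.2.trans (le_max_right _ _)
        simp only [h, this, and_self, if_true]
      · rw [if_neg h]
        by_cases hi : i = 0
        · rw [hi, hx0]
        · exact (hxp i (by omega)).symm
    rw [e] at h1
    exact h1
  intro hfin
  have hsub : ∀ j, (f j).1.2.1 ⊆ hfin.toFinset := by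
    intro j p hp
    rw [Set.Finite.mem_toFinset]
    exact ⟨ε, hgood j p hp⟩
  have h1 := Finset.card_le_card (hsub (hfin.toFinset.card + 1))
  have h2 := (f (hfin.toFinset.card + 1)).2.1
  omega

theorem stmt4 (k : ℕ) (hk : 1 ≤ k) :
    ∃ R : List ℕ → ℕ, (∀ s, 1 ≤ R s) ∧
      ∀ m : ℕ → ℕ, (∀ j, 1 ≤ m j) →
      ∀ c : ℕ → Finset ℕ → (ℕ → ℕ) → Bool,
        ∃ H : ℕ → Finset ℕ,
          (∀ j, H j ⊆ Finset.range (R ((List.range (j + 1)).map m))) ∧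
          (∀ j, (H j).card = m j) ∧
          {n : ℕ | ∃ ε : Bool, ∀ A : Finset ℕ, A ⊆ H 0 → A.card = k →
              ∀ x : ℕ → ℕ, (∀ j, 1 ≤ j → j ≤ n → x j ∈ H j) →
                x 0 = 0 → (∀ j, n < j → x j = 0) →
                c n A x = ε}.Infinite := by
  refine ⟨fun s => max 1 (Rf k (fun i => s.getD i 1) (s.length - 1)), fun s => le_max_left _ _, ?_⟩
  intro m hm c
  obtain ⟨H, h1, h2, h3⟩ := main_aux k m hm c
  refine ⟨H, fun j => (h1 j).trans ?_, h2, h3⟩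
  apply Finset.range_subset_range.2
  refine le_trans (le_of_eq ?_) (le_max_right _ _)
  have hl : ((List.range (j + 1)).map m).length - 1 = j := by simp
  rw [hl]
  apply Rf_congr
  intro i hi
  have : i < j + 1 := by omega
  simp [List.getD, this]
end

section
/- For each k ≥ 1, there is an infinite subset N ⊆ ω such that M_o →^k M_e holds for every infinite subset M of N. -/
/- The relation M_o →^k M_e for an infinite M ⊆ ω with increasing enumeration
(f j)_{j<ω}: for each 2-coloring c : ⋃_{n<ω} ([f 1]^k × ∏_{j=1}^n f (2j+1)) → 2, there
are H_j ⊆ f (2j+1) with |H_j| = f (2j) for each j, such that c is constant on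
[H_0]^k × ∏_{j=1}^n H_j for infinitely many n.

A natural number m is identified with {0,…,m−1} = Finset.range m.  A point is encoded
as (n, A, x), A being the k-element subset at coordinate 0 and x : ℕ → ℕ the
coordinates 1,…,n, with the canonical convention x j = 0 for irrelevant coordinates. -/
def oddToEven (k : ℕ) (f : ℕ → ℕ) : Prop :=
  ∀ c : ℕ → Finset ℕ → (ℕ → ℕ) → Bool,
    ∃ H : ℕ → Finset ℕ,
      (∀ j, H j ⊆ Finset.range (f (2 * j + 1))) ∧
      (∀ j, (H j).card = f (2 * j)) ∧
      {n : ℕ | ∃ ε : Bool, ∀ A : Finset ℕ, A ⊆ H 0 → A.card = k →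
          ∀ x : ℕ → ℕ, (∀ j, 1 ≤ j → j ≤ n → x j ∈ H j) →
            x 0 = 0 → (∀ j, n < j → x j = 0) →
            c n A x = ε}.Infinite


theorem ramsey_aux (k : ℕ) : ∀ m : ℕ, ∃ N : ℕ, ∀ X : Finset ℕ, N ≤ X.card →
    ∀ c : Finset ℕ → Bool, ∃ H ⊆ X, H.card = m ∧ ∃ ε : Bool, ∀ A ⊆ H, A.card = k → c A = ε := by
  induction k with
  | zero =>
    intro m
    refine ⟨m, fun X hX c => ?_⟩
    obtain ⟨H, hH, hc⟩ := Finset.exists_subset_card_eq hX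
    refine ⟨H, hH, hc, c ∅, fun A _ h => ?_⟩
    rw [Finset.card_eq_zero.1 h]
  | succ k ih =>
    have key : ∀ s p q : ℕ, p + q = s → ∃ N : ℕ, ∀ X : Finset ℕ, N ≤ X.card →
        ∀ c : Finset ℕ → Bool,
        (∃ H ⊆ X, H.card = p ∧ ∀ A ⊆ H, A.card = k + 1 → c A = true) ∨
        (∃ H ⊆ X, H.card = q ∧ ∀ A ⊆ H, A.card = k + 1 → c A = false) := by
      intro s
      induction s with
      | zero =>
        intro p q h
        refine ⟨0, fun X _ c => Or.inl ⟨∅, by simp, by simp; omega, ?_⟩⟩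
        intro A hA h
        rw [Finset.subset_empty.1 hA] at h
        simp at h
      | succ s ihs =>
        intro p q h
        rcases p with _ | p
        · refine ⟨0, fun X _ c => Or.inl ⟨∅, by simp, by simp, ?_⟩⟩
          intro A hA h
          rw [Finset.subset_empty.1 hA] at h
          simp at h
        rcases q with _ | q
        · refine ⟨0, fun X _ c => Or.inr ⟨∅, by simp, by simp, ?_⟩⟩
          intro A hA h
          rw [Finset.subset_empty.1 hA] at h
          simp at h
        obtain ⟨N1, h1⟩ := ihs p (q + 1) (by omega)
        obtain ⟨N2, h2⟩ := ihs (p + 1) q (by omega)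
        obtain ⟨N, hN⟩ := ih (max N1 N2)
        refine ⟨N + 1, fun X hX c => ?_⟩
        obtain ⟨a, ha⟩ : X.Nonempty := Finset.card_pos.1 (by omega)
        obtain ⟨H, hH, hHc, ε, hε⟩ := hN (X.erase a)
          (by rw [Finset.card_erase_of_mem ha]; omega) (fun A => c (insert a A))
        have haH : a ∉ H := fun h => by simpa using hH h
        have hHX : H ⊆ X := hH.trans (Finset.erase_subset _ _)
        have ext : ∀ E ⊆ H, ∀ A ⊆ insert a E, A.card = k + 1 → (∀ A ⊆ E, A.card = k + 1 → c A = ε) →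
            c A = ε := by
          intro E hE A hA hAc hEc
          by_cases haA : a ∈ A
          · have := hε (A.erase a) (by
              intro y hy
              have h1 := Finset.mem_erase.1 hy
              exact hE ((Finset.mem_insert.1 (hA h1.2)).resolve_left h1.1))
              (by rw [Finset.card_erase_of_mem haA]; omega)
            simpa [Finset.insert_erase haA] using this
          · exact hEc A ((Finset.subset_insert_iff_of_notMem haA).1 hA) hAc
        cases ε with
        | true =>
          rcases h1 H (by omega) c with ⟨E, hE, hEc, hEt⟩ | ⟨E, hE, hEc, hEt⟩
          · refine Or.inl ⟨insert a E, ?_, ?_, ?_⟩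
            · exact Finset.insert_subset ha (hE.trans hHX)
            · rw [Finset.card_insert_of_notMem (fun h => haH (hE h)), hEc]
            · exact fun A hA hAc => ext E hE A hA hAc hEt
          · exact Or.inr ⟨E, hE.trans hHX, hEc, hEt⟩
        | false =>
          rcases h2 H (by omega) c with ⟨E, hE, hEc, hEt⟩ | ⟨E, hE, hEc, hEt⟩
          · exact Or.inl ⟨E, hE.trans hHX, hEc, hEt⟩
          · refine Or.inr ⟨insert a E, ?_, ?_, ?_⟩
            · exact Finset.insert_subset ha (hE.trans hHX)
            · rw [Finset.card_insert_of_notMem (fun h => haH (hE h)), hEc]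
            · exact fun A hA hAc => ext E hE A hA hAc hEt
    intro m
    obtain ⟨N, hN⟩ := key _ m m rfl
    refine ⟨N, fun X hX c => ?_⟩
    rcases hN X hX c with ⟨H, a, b, h⟩ | ⟨H, a, b, h⟩
    · exact ⟨H, a, b, _, h⟩
    · exact ⟨H, a, b, _, h⟩

/-- reductions -/
def FRed {D : ℕ → Type} (c : ∀ n, D n) (Step : ∀ i, Finset ℕ → D i → D (i + 1) → Prop)
    (L : ℕ → Finset ℕ → ℕ → Prop) (j : ℕ) (Y : ℕ → Finset ℕ) (d : D j) : Prop :=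
  ∀ B : ℕ, ∃ n, B < n ∧ ∃ Z : ℕ → Finset ℕ, (∀ i, j ≤ i → Z i ⊆ Y i ∧ L i (Z i) 0) ∧
    ∃ δ : ∀ i, D i, δ j = d ∧ δ n = c n ∧
      ∀ i, j ≤ i → i < n → Step i (Z i) (δ i) (δ (i + 1))

theorem FRed.mono {D : ℕ → Type} {c : ∀ n, D n} {Step : ∀ i, Finset ℕ → D i → D (i + 1) → Prop}
    {L : ℕ → Finset ℕ → ℕ → Prop} {j : ℕ} {Y Y' : ℕ → Finset ℕ} {d : D j}
    (h : FRed c Step L j Y d) (hY : ∀ i, j ≤ i → Y i ⊆ Y' i) : FRed c Step L j Y' d := by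
  intro B
  obtain ⟨n, hn, Z, hZ, r⟩ := h B
  exact ⟨n, hn, Z, fun i hi => ⟨(hZ i hi).1.trans (hY i hi), (hZ i hi).2⟩, r⟩

theorem stage_aux {D : ℕ → Type} (c : ∀ n, D n) (Step : ∀ i, Finset ℕ → D i → D (i + 1) → Prop)
    (L : ℕ → Finset ℕ → ℕ → Prop)
    (hL : ∀ i Y s t, s ≤ t → L i Y t → L i Y s) (j : ℕ) (l : List (D j)) :
    ∀ (Y : ℕ → Finset ℕ) (b r : ℕ → ℕ),
      (∀ i, j ≤ i → L i (Y i) (b i + 2 ^ (l.length + r i))) →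
      ∃ (Y' : ℕ → Finset ℕ) (b' : ℕ → ℕ),
        (∀ i, Y' i ⊆ Y i) ∧ (∀ i, b i ≤ b' i) ∧ (∀ i, i < j → Y' i = Y i ∧ b' i = b i) ∧
        (∀ i, j ≤ i → L i (Y' i) (b' i + 2 ^ (r i))) ∧
        ∀ d ∈ l, FRed c Step L j Y' d → ∀ Z : ℕ → Finset ℕ,
          (∀ i, j ≤ i → Z i ⊆ Y' i ∧ L i (Z i) (b' i)) → FRed c Step L j Z d := by
  induction l with
  | nil =>
    intro Y b r h
    exact ⟨Y, b, fun _ => subset_rfl, fun _ => le_rfl, fun _ _ => ⟨rfl, rfl⟩, by simpa using h,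
      by simp⟩
  | cons d l ih =>
    intro Y b r h
    have e : ∀ i, (2:ℕ) ^ ((d :: l).length + r i) = 2 ^ (l.length + r i) + 2 ^ (l.length + r i) := by
      intro i
      rw [List.length_cons, show l.length + 1 + r i = (l.length + r i) + 1 by omega, pow_succ]
      omega
    by_cases hd : ∃ Z : ℕ → Finset ℕ, (∀ i, j ≤ i → Z i ⊆ Y i ∧
        L i (Z i) (b i + 2 ^ (l.length + r i))) ∧ ¬ FRed c Step L j Z d
    · obtain ⟨Z, hZ, hZd⟩ := hd
      obtain ⟨Y', b', h1, h2, h3, h4, h5⟩ := ih (fun i => if j ≤ i then Z i else Y i) b r (by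
        intro i hi
        simpa [hi] using (hZ i hi).2)
      refine ⟨Y', b', fun i => (h1 i).trans ?_, h2, fun i hi => ?_, h4, ?_⟩
      · split_ifs with hi
        · exact (hZ i hi).1
        · exact subset_rfl
      · have := h3 i hi
        rwa [if_neg (by omega)] at this
      · intro d' hd' hF
        rcases List.mem_cons.1 hd' with rfl | hd'
        · refine absurd (hF.mono fun i hi => ?_) hZd
          have := h1 i
          rwa [if_pos hi] at this
        · exact h5 d' hd' hF
    · push Not at hd
      obtain ⟨Y', b', h1, h2, h3, h4, h5⟩ := ih Y
        (fun i => if j ≤ i then b i + 2 ^ (l.length + r i) else b i) r (by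
        intro i hi
        have := h i hi
        rw [e] at this
        simpa [hi, add_assoc] using this)
      refine ⟨Y', b', h1, fun i => le_trans ?_ (h2 i), fun i hi => ?_, h4, ?_⟩
      · split_ifs
        · exact Nat.le_add_right _ _
        · exact le_rfl
      · have := h3 i hi
        rwa [if_neg (by omega)] at this
      · intro d' hd' hF
        rcases List.mem_cons.1 hd' with rfl | hd'
        · intro Z hZ
          refine hd Z fun i hi => ⟨(hZ i hi).1.trans (h1 i), hL i _ _ _ ?_ (hZ i hi).2⟩
          have := h2 i
          rwa [if_pos hi] at this
        · exact h5 d' hd' hF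

theorem fusion_aux {D : ℕ → Type} [∀ i, Fintype (D i)] (c : ∀ n, D n)
    (Step : ∀ i, Finset ℕ → D i → D (i + 1) → Prop)
    (L : ℕ → Finset ℕ → ℕ → Prop)
    (hL : ∀ i Y s t, s ≤ t → L i Y t → L i Y s)
    (X : ℕ → Finset ℕ)
    (hX : ∀ i, L i (X i) (2 ^ (∑ l ∈ Finset.Ico 0 (i + 1), Fintype.card (D l)))) :
    ∃ (Y : ℕ → Finset ℕ) (b : ℕ → ℕ), (∀ i, Y i ⊆ X i) ∧ (∀ i, L i (Y i) (b i + 1)) ∧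
      ∀ j (d : D j), FRed c Step L j Y d → ∀ Z : ℕ → Finset ℕ,
          (∀ i, j ≤ i → Z i ⊆ Y i ∧ L i (Z i) (b i)) → FRed c Step L j Z d := by
  let St := (ℕ → Finset ℕ) × (ℕ → ℕ)
  let Inv : ℕ → St → Prop := fun j s =>
    ∀ i, j ≤ i → L i (s.1 i) (s.2 i + 2 ^ (∑ l ∈ Finset.Ico j (i + 1), Fintype.card (D l)))
  let Rel : ℕ → St → St → Prop := fun j s s' =>
    (∀ i, s'.1 i ⊆ s.1 i) ∧ (∀ i, s.2 i ≤ s'.2 i) ∧ (∀ i, i < j → s'.1 i = s.1 i ∧ s'.2 i = s.2 i) ∧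
    (∀ i, j ≤ i → L i (s'.1 i) (s'.2 i + 2 ^ (∑ l ∈ Finset.Ico (j + 1) (i + 1), Fintype.card (D l)))) ∧
    ∀ d : D j, FRed c Step L j s'.1 d → ∀ Z : ℕ → Finset ℕ,
          (∀ i, j ≤ i → Z i ⊆ s'.1 i ∧ L i (Z i) (s'.2 i)) → FRed c Step L j Z d
  have step : ∀ j (s : St), Inv j s → ∃ s' : St, Rel j s s' := by
    intro j s hs
    obtain ⟨Y', b', h1, h2, h3, h4, h5⟩ := stage_aux c Step L hL j (Finset.univ : Finset (D j)).toList
      s.1 s.2 (fun i => ∑ l ∈ Finset.Ico (j + 1) (i + 1), Fintype.card (D l)) (by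
        intro i hi
        have := hs i hi
        rw [Finset.sum_eq_sum_Ico_succ_bot (by omega)] at this
        simpa using this)
    exact ⟨(Y', b'), h1, h2, h3, h4, fun d => h5 d (by simp)⟩
  have hinv : ∀ j s s', Rel j s s' → Inv (j + 1) s' := by
    intro j s s' h i hi
    exact h.2.2.2.1 i (by omega)
  classical
  choose! nx hnx using step
  let S : ℕ → St := fun j => Nat.rec (X, fun _ => 0) (fun j s => nx j s) j
  have S0 : S 0 = (X, fun _ => 0) := rfl
  have SS : ∀ j, S (j + 1) = nx j (S j) := fun j => rfl
  have hI : ∀ j, Inv j (S j) := by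
    intro j
    induction j with
    | zero => intro i _; simpa [S0] using hX i
    | succ j ih => exact hinv j (S j) _ (hnx j _ ih)
  have hR : ∀ j, Rel j (S j) (S (j + 1)) := fun j => hnx j _ (hI j)
  have hY : ∀ i j j', j ≤ j' → (S j').1 i ⊆ (S j).1 i ∧ (S j).2 i ≤ (S j').2 i := by
    intro i j j' h
    induction j', h using Nat.le_induction with
    | base => exact ⟨subset_rfl, le_rfl⟩
    | succ m hm ih => exact ⟨((hR m).1 i).trans ih.1, ih.2.trans ((hR m).2.1 i)⟩
  refine ⟨fun i => (S (i + 1)).1 i, fun i => (S (i + 1)).2 i, fun i => (hY i 0 (i + 1) (by omega)).1,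
    fun i => ?_, ?_⟩
  · have := (hR i).2.2.2.1 i le_rfl
    simpa using this
  · intro j d hF Z hZ
    refine (hR j).2.2.2.2 d (hF.mono fun i hi => (hY i (j + 1) (i + 1) (by omega)).1) Z fun i hi => ?_
    exact ⟨(hZ i hi).1.trans (hY i (j + 1) (i + 1) (by omega)).1,
      hL i _ _ _ (hY i (j + 1) (i + 1) (by omega)).2 (hZ i hi).2⟩

theorem main_aux_s6 {D : ℕ → Type} [∀ i, Fintype (D i)] (c : ∀ n, D n)
    (Step : ∀ i, Finset ℕ → D i → D (i + 1) → Prop)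
    (hS : ∀ i Z Z' d g, Z' ⊆ Z → Step i Z d g → Step i Z' d g)
    (L : ℕ → Finset ℕ → ℕ → Prop)
    (hL : ∀ i Y s t, s ≤ t → L i Y t → L i Y s)
    (hbig : ∀ i Y t, L i Y (t + 1) → ∀ g : D (i + 1), ∃ Z ⊆ Y, L i Z t ∧ ∃ d : D i, Step i Z d g)
    (X : ℕ → Finset ℕ)
    (hX : ∀ i, L i (X i) (2 ^ (∑ l ∈ Finset.Ico 0 (i + 1), Fintype.card (D l)))) :
    ∃ (d0 : D 0) (Z : ℕ → Finset ℕ), (∀ i, Z i ⊆ X i ∧ L i (Z i) 0) ∧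
      ∀ B : ℕ, ∃ n, B < n ∧ ∃ δ : ∀ i, D i, δ 0 = d0 ∧ δ n = c n ∧
        ∀ i, i < n → Step i (Z i) (δ i) (δ (i + 1)) := by
  classical
  obtain ⟨Y, b, hYX, hYL, hmin⟩ := fusion_aux c Step L hL X hX
  -- reduce each colouring
  have red : ∀ n, ∃ (Z : ℕ → Finset ℕ) (δ : ∀ i, D i), (∀ i, Z i ⊆ Y i ∧ L i (Z i) (b i)) ∧
      δ n = c n ∧ ∀ i, i < n → Step i (Z i) (δ i) (δ (i + 1)) := by
    intro n
    have : ∀ m, m ≤ n → ∃ (Z : ℕ → Finset ℕ) (δ : ∀ i, D i), (∀ i, Z i ⊆ Y i ∧ L i (Z i) (b i)) ∧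
      δ n = c n ∧ ∀ i, n - m ≤ i → i < n → Step i (Z i) (δ i) (δ (i + 1)) := by
      intro m
      induction m with
      | zero =>
        intro _
        exact ⟨Y, c, fun i => ⟨subset_rfl, hL i _ _ _ (by omega) (hYL i)⟩, rfl,
          fun i h h' => by omega⟩
      | succ m ih =>
        intro hm
        obtain ⟨Z, δ, h1, h2, h3⟩ := ih (by omega)
        obtain ⟨p, hp⟩ : ∃ p, p = n - (m + 1) := ⟨_, rfl⟩
        obtain ⟨W, hW, hWL, d, hd⟩ := hbig p (Y p) (b p) (hYL p) (δ (p + 1))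
        refine ⟨Function.update Z p W, Function.update δ p d, fun i => ?_, ?_, ?_⟩
        · by_cases hi : i = p
          · subst hi; simpa using ⟨hW, hWL⟩
          · simpa [hi] using h1 i
        · rw [Function.update_of_ne (by omega), h2]
        · intro i hi hin
          by_cases hi' : i = p
          · subst hi'
            rw [Function.update_self, Function.update_self, Function.update_of_ne (by omega)]
            exact hd
          · rw [Function.update_of_ne hi', Function.update_of_ne hi',
              Function.update_of_ne (by omega)]
            exact h3 i (by omega) hin
    obtain ⟨Z, δ, h1, h2, h3⟩ := this n le_rfl
    exact ⟨Z, δ, h1, h2, fun i hi => h3 i (by omega) hi⟩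
  choose Zn δn hZn hδn hstep using red
  let U : Ultrafilter ℕ := Filter.hyperfilter ℕ
  have hUinf : ∀ B, ∀ᶠ n in (U : Filter ℕ), B < n := by
    intro B
    have : ∀ᶠ n in Filter.atTop, B < n := Filter.eventually_gt_atTop B
    rw [← Nat.cofinite_eq_atTop] at this
    exact this.filter_mono Filter.hyperfilter_le_cofinite
  have hH : ∀ i, ∃ H : Finset ℕ, ∀ᶠ n in (U : Filter ℕ), Zn n i = H := by
    intro i
    have := (Ultrafilter.eventually_exists_mem_iff (f := U)
      (is := ((Y i).powerset : Set (Finset ℕ))) (P := fun H n => Zn n i = H)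
      (Finset.finite_toSet _)).1 (Filter.Eventually.of_forall fun n => ⟨Zn n i, by
        simpa using (hZn n i).1, rfl⟩)
    obtain ⟨H, _, h⟩ := this
    exact ⟨H, h⟩
  have hD : ∀ i, ∃ d : D i, ∀ᶠ n in (U : Filter ℕ), δn n i = d := by
    intro i
    have := (Ultrafilter.eventually_exists_mem_iff (f := U)
      (is := (Set.univ : Set (D i))) (P := fun H n => δn n i = H)
      (Set.toFinite _)).1 (Filter.Eventually.of_forall fun n => ⟨δn n i, by
        simp, rfl⟩)
    obtain ⟨H, _, h⟩ := this
    exact ⟨H, h⟩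
  choose H hH using hH
  choose δ hδ using hD
  have hHY : ∀ i, H i ⊆ Y i ∧ L i (H i) (b i) := by
    intro i
    obtain ⟨n, hn⟩ := (hH i).exists
    rw [← hn]; exact hZn n i
  have hHs : ∀ i, Step i (H i) (δ i) (δ (i + 1)) := by
    intro i
    obtain ⟨n, h1, h2, h3, h4⟩ := ((hH i).and ((hδ i).and ((hδ (i+1)).and (hUinf i)))).exists
    rw [← h1, ← h2, ← h3]
    exact hstep n i h4
  have hF : ∀ j, FRed c Step L j H (δ j) := by
    intro j
    refine hmin j (δ j) ?_ H fun i _ => hHY i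
    intro B
    obtain ⟨n, h1, h2⟩ := ((hδ j).and (hUinf B)).exists
    exact ⟨n, h2, Zn n, fun i _ => ⟨(hZn n i).1, hL i _ _ _ (by omega) (hZn n i).2⟩, δn n, h1,
      hδn n, fun i _ hi => hstep n i hi⟩
  have hF' := fun j => hF j j
  choose nx hnx W hW δ' h1 h2 h3 using hF'
  let p : ℕ → ℕ := fun i => Nat.rec 0 (fun i q => if nx q = i + 1 then i + 1 else q) i
  have p0 : p 0 = 0 := rfl
  have pS : ∀ i, p (i + 1) = if nx (p i) = i + 1 then i + 1 else p i := fun i => rfl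
  have hpi : ∀ i, p i ≤ i ∧ i < nx (p i) := by
    intro i
    induction i with
    | zero => exact ⟨le_rfl, by have := hnx 0; rw [p0]; exact this⟩
    | succ i ih =>
      rw [pS]
      split_ifs with h
      · exact ⟨le_rfl, hnx _⟩
      · omega
  have hpc : ∀ q, p q = q → ∀ i, q ≤ i → i < nx q → p i = q := by
    intro q hq i hi
    induction i, hi using Nat.le_induction with
    | base => intro _; exact hq
    | succ i hi ih =>
      intro h
      rw [pS, ih (by omega), if_neg (by omega)]
  have hpn : ∀ q, p q = q → p (nx q) = nx q := by
    intro q hq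
    have := hnx q
    obtain ⟨r, hr⟩ : ∃ r, nx q = r + 1 := ⟨nx q - 1, by omega⟩
    rw [hr, pS, hpc q hq r (by omega) (by omega), if_pos hr]
  have hZH : ∀ i, W (p i) i ⊆ H i := fun i => (hW (p i) i (hpi i).1).1
  refine ⟨δ 0, fun i => W (p i) i, fun i => ⟨(hZH i).trans ((hHY i).1.trans (hYX i)),
    (hW (p i) i (hpi i).1).2⟩, ?_⟩
  have hq : ∀ B, ∃ q, B ≤ q ∧ p q = q := by
    intro B
    induction B with
    | zero => exact ⟨0, le_rfl, p0⟩
    | succ B ih =>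
      obtain ⟨q, hq, hpq⟩ := ih
      exact ⟨nx q, by have := hnx q; omega, hpn q hpq⟩
  intro B
  obtain ⟨q, hBq, hpq⟩ := hq B
  have hlt := hnx q
  refine ⟨nx q, by omega, fun i => if i ≤ q then δ i else δ' q i, by simp, ?_, ?_⟩
  · beta_reduce
    rw [if_neg (show ¬ nx q ≤ q by omega), h2]
  · intro i hi
    beta_reduce
    rcases lt_trichotomy i q with h | h | h
    · rw [if_pos (show i ≤ q by omega), if_pos (show i + 1 ≤ q by omega)]
      exact hS i _ _ _ _ (hZH i) (hHs i)
    · subst h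
      rw [if_pos (show i ≤ i by omega), if_neg (show ¬ i + 1 ≤ i by omega), hpq, ← h1]
      exact h3 i i le_rfl hi
    · rw [if_neg (show ¬ i ≤ q by omega), if_neg (show ¬ i + 1 ≤ q by omega),
        hpc q hpq i (by omega) hi]
      exact h3 q i (by omega) hi

open Classical in
/-- points of level `i` -/
noncomputable def Qpt (f : ℕ → ℕ) : ℕ → Finset (Finset ℕ × (ℕ → ℕ))
  | 0 => (Finset.range (f 1)).powerset.image (fun A => (A, fun _ => 0))
  | i + 1 => (Qpt f i ×ˢ Finset.range (f (2 * i + 3))).image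
      (fun q => (q.1.1, Function.update q.1.2 (i + 1) q.2))

theorem mem_Qpt (f : ℕ → ℕ) (A : Finset ℕ) (hA : A ⊆ Finset.range (f 1)) (i : ℕ) :
    ∀ x : ℕ → ℕ, x 0 = 0 → (∀ j, 1 ≤ j → j ≤ i → x j < f (2 * j + 1)) →
      (∀ j, i < j → x j = 0) → (A, x) ∈ Qpt f i := by
  classical
  induction i with
  | zero =>
    intro x h0 _ h
    refine Finset.mem_image.2 ⟨A, by simpa using hA, ?_⟩
    congr 1
    funext j
    rcases Nat.eq_zero_or_pos j with rfl | hj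
    · exact h0.symm
    · exact (h j hj).symm
  | succ i ih =>
    intro x h0 h1 h2
    refine Finset.mem_image.2 ⟨((A, Function.update x (i + 1) 0), x (i + 1)), ?_, ?_⟩
    · refine Finset.mem_product.2 ⟨ih _ ?_ ?_ ?_, ?_⟩
      · rw [Function.update_of_ne (by omega), h0]
      · intro j hj hji
        rw [Function.update_of_ne (by omega)]
        exact h1 j hj (by omega)
      · intro j hj
        by_cases h : j = i + 1
        · rw [h, Function.update_self]
        · rw [Function.update_of_ne h]
          exact h2 j (by omega)
      · simpa [show 2 * (i + 1) + 1 = 2 * i + 3 by ring] using h1 (i + 1) (by omega) le_rfl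
    · simp

theorem card_Qpt (f : ℕ → ℕ) (u : ℕ) (i : ℕ) (h : ∀ j, j ≤ i → f (2 * j + 1) ≤ u) :
    (Qpt f i).card ≤ 2 ^ u * u ^ i := by
  classical
  induction i with
  | zero =>
    refine Finset.card_image_le.trans ?_
    rw [Finset.card_powerset, Finset.card_range, pow_zero, mul_one]
    exact Nat.pow_le_pow_right (by norm_num) (h 0 le_rfl)
  | succ i ih =>
    refine Finset.card_image_le.trans ?_
    rw [Finset.card_product, Finset.card_range, pow_succ, ← mul_assoc]
    exact Nat.mul_le_mul (ih fun j hj => h j (by omega)) (h (i + 1) le_rfl)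

/-- growth -/
def Gr (u : ℕ) : ℕ := u * (2 ^ (2 ^ u * u ^ u)) ^ (2 ^ (u * 2 ^ (2 ^ u * u ^ u)))

theorem odd_of_growth (k : ℕ) (f : ℕ → ℕ) (hf : StrictMono f)
    (hR : ∀ c : Finset ℕ → Bool, ∃ H ⊆ Finset.range (f 1), H.card = f 0 ∧
      ∃ ε : Bool, ∀ A ⊆ H, A.card = k → c A = ε)
    (hG : ∀ i, Gr (f (2 * i + 2)) ≤ f (2 * i + 3)) : oddToEven k f := by
  classical
  intro c
  let D : ℕ → Type := fun i => ↥(Qpt f i).powerset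
  let C : ∀ n, D n := fun n => ⟨(Qpt f n).filter (fun p => c n p.1 p.2 = true), by simp⟩
  let Step : ∀ i, Finset ℕ → D i → D (i + 1) → Prop := fun i Z d g =>
    ∀ p ∈ Qpt f i, ∀ v ∈ Z, ((p.1, Function.update p.2 (i + 1) v) ∈ g.1 ↔ p ∈ d.1)
  let L : ℕ → Finset ℕ → ℕ → Prop := fun i Y t =>
    f (2 * i + 2) * (2 ^ (Qpt f i).card) ^ t ≤ Y.card
  have hcard : ∀ i, Fintype.card (D i) = 2 ^ (Qpt f i).card := by
    intro i
    rw [Fintype.card_coe, Finset.card_powerset]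
  have hS1 : ∀ i Z Z' d g, Z' ⊆ Z → Step i Z d g → Step i Z' d g := by
    intro i Z Z' d g hZ h p hp v hv
    exact h p hp v (hZ hv)
  have hL1 : ∀ i Y s t, s ≤ t → L i Y t → L i Y s := by
    intro i Y s t hst h
    refine le_trans ?_ h
    exact Nat.mul_le_mul_left _ (Nat.pow_le_pow_right (by positivity) hst)
  have hB1 : ∀ i Y t, L i Y (t + 1) → ∀ g : D (i + 1), ∃ Z ⊆ Y, L i Z t ∧ ∃ d : D i, Step i Z d g := by
    intro i Y t h g
    let φ : ℕ → Finset (Finset ℕ × (ℕ → ℕ)) := fun v =>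
      (Qpt f i).filter (fun p => (p.1, Function.update p.2 (i + 1) v) ∈ g.1)
    obtain ⟨d, hd, hdc⟩ := Finset.exists_le_card_fiber_of_mul_le_card_of_maps_to
      (s := Y) (t := (Qpt f i).powerset) (f := φ)
      (n := f (2 * i + 2) * (2 ^ (Qpt f i).card) ^ t)
      (fun v _ => by simp [φ]) ⟨∅, by simp⟩
      (by
        rw [Finset.card_powerset]
        refine le_trans (le_of_eq ?_) h
        rw [pow_succ]; ring)
    refine ⟨_, Finset.filter_subset _ _, hdc, ⟨d, hd⟩, ?_⟩
    intro p hp v hv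
    have := (Finset.mem_filter.1 hv).2
    change _ ↔ p ∈ d
    rw [← this]
    simp [φ, hp]
  have hX1 : ∀ i, L i (Finset.range (f (2 * i + 3)))
      (2 ^ (∑ l ∈ Finset.Ico 0 (i + 1), Fintype.card (D l))) := by
    intro i
    change f (2 * i + 2) * _ ≤ _
    rw [Finset.card_range]
    refine le_trans ?_ (hG i)
    have hu : 2 * i + 2 ≤ f (2 * i + 2) := hf.le_apply
    generalize hue : f (2 * i + 2) = u at hu
    have hq : ∀ l, l ≤ i → (Qpt f l).card ≤ 2 ^ u * u ^ u := by
      intro l hl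
      refine (card_Qpt f u l fun j hj => ?_).trans ?_
      · rw [← hue]; exact hf.monotone (by omega)
      · exact Nat.mul_le_mul_left _ (Nat.pow_le_pow_right (by omega) (by omega))
    have hsum : ∑ l ∈ Finset.Ico 0 (i + 1), Fintype.card (D l) ≤ u * 2 ^ (2 ^ u * u ^ u) := by
      refine (Finset.sum_le_card_nsmul _ _ (2 ^ (2 ^ u * u ^ u)) ?_).trans ?_
      · intro l hl
        rw [hcard]
        exact Nat.pow_le_pow_right (by norm_num) (hq l (by simp at hl; omega))
      · rw [Nat.card_Ico, smul_eq_mul]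
        exact Nat.mul_le_mul_right _ (by omega)
    unfold Gr
    refine Nat.mul_le_mul_left _ ?_
    calc _ ≤ (2 ^ (2 ^ u * u ^ u)) ^ (2 ^ (∑ l ∈ Finset.Ico 0 (i + 1), Fintype.card (D l))) :=
          Nat.pow_le_pow_left (Nat.pow_le_pow_right (by norm_num) (hq i le_rfl)) _
      _ ≤ _ := Nat.pow_le_pow_right (by positivity) (Nat.pow_le_pow_right (by norm_num) hsum)
  obtain ⟨d0, Z, hZ, hinf⟩ := main_aux_s6 C Step hS1 L hL1 hB1
    (fun i => Finset.range (f (2 * i + 3))) hX1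
  · obtain ⟨H0, hH0, hH0c, ε, hε⟩ := hR (fun A => decide ((A, fun _ => 0) ∈ d0.1))
    have hsub : ∀ i, ∃ W ⊆ Z i, W.card = f (2 * i + 2) := fun i =>
      Finset.exists_subset_card_eq (by simpa [L] using (hZ i).2)
    choose W hW hWc using hsub
    refine ⟨fun j => if j = 0 then H0 else W (j - 1), ?_, ?_, ?_⟩
    · intro j
      rcases j with _ | j
      · simpa using hH0
      · have := (hW j).trans (hZ j).1
        simpa [show 2 * (j + 1) + 1 = 2 * j + 3 by ring] using this
    · intro j
      rcases j with _ | j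
      · simpa using hH0c
      · have := hWc j
        simpa [show 2 * (j + 1) = 2 * j + 2 by ring] using this
    · refine Set.infinite_of_forall_exists_gt fun B => ?_
      obtain ⟨n, hn, δ, h0, hδ, hs⟩ := hinf B
      refine ⟨n, ⟨ε, ?_⟩, hn⟩
      intro A hA hAk x hx hx0 hxn
      have hA' : A ⊆ Finset.range (f 1) := fun a ha => hH0 (by simpa using hA ha)
      have hxW : ∀ i, i < n → x (i + 1) ∈ Z i := fun i hi =>
        hW i (by simpa using hx (i + 1) (by omega) hi)
      have hxlt : ∀ j, 1 ≤ j → j ≤ n → x j < f (2 * j + 1) := by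
        intro j hj hjn
        obtain ⟨i, rfl⟩ : ∃ i, j = i + 1 := ⟨j - 1, by omega⟩
        have := (hZ i).1 (hxW i hjn)
        simpa [show 2 * (i + 1) + 1 = 2 * i + 3 by ring] using this
      have hQ : ∀ i, i ≤ n → (A, fun j => if j ≤ i then x j else 0) ∈ Qpt f i := by
        intro i hi
        refine mem_Qpt f A hA' i _ (by simpa using hx0) ?_ ?_
        · intro j hj hji
          rw [if_pos hji]
          exact hxlt j hj (by omega)
        · intro j hj
          rw [if_neg (by omega)]
      have key : ∀ i, i ≤ n →
          ((A, fun j => if j ≤ i then x j else 0) ∈ (δ i).1 ↔ (A, fun _ => 0) ∈ d0.1) := by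
        intro i
        induction i with
        | zero =>
          intro _
          rw [← h0]
          have : (fun j => if j ≤ 0 then x j else 0) = (fun _ => 0 : ℕ → ℕ) := by
            funext j
            split_ifs with h
            · rw [Nat.le_zero.1 h, hx0]
            · rfl
          rw [this]
        | succ i ih =>
          intro hi
          rw [← ih (by omega), ← hs i hi _ (hQ i (by omega)) (x (i + 1)) (hxW i hi)]
          have : (fun j => if j ≤ i + 1 then x j else 0) =
              Function.update (fun j => if j ≤ i then x j else 0) (i + 1) (x (i + 1)) := by
            funext j
            by_cases h : j = i + 1
            · subst h; simp
            · rw [Function.update_of_ne h]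
              by_cases h' : j ≤ i
              · rw [if_pos h', if_pos (by omega)]
              · rw [if_neg h', if_neg (by omega)]
          rw [this]
      have hxe : (fun j => if j ≤ n then x j else 0) = x := by
        funext j
        split_ifs with h
        · rfl
        · exact (hxn j (by omega)).symm
      have k1 := key n le_rfl
      have k2 := hQ n le_rfl
      rw [hxe] at k1 k2
      rw [hδ] at k1
      have k3 : (A, x) ∈ (C n).1 ↔ c n A x = true := by
        simp [C, k2]
      rw [k3] at k1
      have k4 := hε A (by simpa using hA) hAk
      rw [← k4, Bool.eq_iff_iff, k1]
      simp

/- STATEMENT 6 (Lemma 3.18 variant):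
For each k ≥ 1, there is an infinite N ⊆ ω (given by its increasing enumeration e)
such that M_o →^k M_e for every infinite subset M of N (given by its increasing
enumeration f, with range f ⊆ range e). -/
theorem stmt6 (k : ℕ) (hk : 1 ≤ k) :
    ∃ e : ℕ → ℕ, StrictMono e ∧
      ∀ f : ℕ → ℕ, StrictMono f → Set.range f ⊆ Set.range e → oddToEven k f := by
  choose R hR using ramsey_aux k
  let e : ℕ → ℕ := fun n => Nat.rec 0 (fun _ a => a + 1 + Gr a + R a) n
  have eS : ∀ n, e (n + 1) = e n + 1 + Gr (e n) + R (e n) := fun n => rfl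
  have he : StrictMono e := strictMono_nat_of_lt_succ fun n => by rw [eS]; omega
  refine ⟨e, he, fun f hf hfe => ?_⟩
  have hstep : ∀ i, f i + 1 + Gr (f i) + R (f i) ≤ f (i + 1) := by
    intro i
    obtain ⟨a, ha⟩ := hfe ⟨i, rfl⟩
    obtain ⟨b, hb⟩ := hfe ⟨i + 1, rfl⟩
    have hab : a < b := by
      rw [← he.lt_iff_lt, ha, hb]
      exact hf (Nat.lt_succ_self i)
    rw [← ha, ← hb, ← eS]
    exact he.monotone hab
  refine odd_of_growth k f hf (fun c => ?_) fun i => ?_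
  · have := hstep 0
    exact hR (f 0) (Finset.range (f 1)) (by rw [Finset.card_range]; rw [zero_add] at this; omega) c
  · have := hstep (2 * i + 2)
    rw [show 2 * i + 2 + 1 = 2 * i + 3 by ring] at this
    omega
end

section
/- (Roslanowski–Shelah, recovered) For any t̄ ∈ PC_∞(K_2, Σ_2), any l ≥ 1, and any coloring d : pos(t̄) → l, there is an s̄ ≤ t̄ in PC_∞(K_2, Σ_2) such that d is constant on pos(s̄). -/
open Filter

/- Example 2.11 of Roslanowski–Shelah.  H_2(n) = 2.  An element of K_2 is an FP
creature t = (nor[t], val[t], dis[t], m^t_dn, m^t_up) with ∅ ≠ dis[t] ⊆ [m^t_dn, m^t_up),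
∅ ≠ val[t] ⊆ 2^{dis[t]} and nor[t] = log₂|val[t]|.  Partial finitary functions are
modelled as f : ℕ → Option ℕ, with domain {j | (f j).isSome}. -/
structure Creature2 where
  mdn : ℕ
  mup : ℕ
  hm : mdn < mup
  dis : Finset ℕ
  hdisne : dis.Nonempty
  hdis : dis ⊆ Finset.Ico mdn mup
  val : Finset (ℕ → Option ℕ)
  hvalne : val.Nonempty
  hdom : ∀ f ∈ val, ∀ j, (f j).isSome ↔ j ∈ dis
  hran : ∀ f ∈ val, ∀ j a, f j = some a → a < 2
  nor : ℝ
  hnor : nor = Real.logb 2 (val.card)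

/- Σ_2(s̄↾u) for a nonempty finite u ⊆ ω (with s̄↾u = (s_i : i ∈ u)): creatures t with
m^t_dn = m^{s_{min u}}_dn, m^t_up = m^{s_{max u}}_up, and dis[t] = dis[s_{l*}],
val[t] ⊆ val[s_{l*}] for some l* ∈ u. -/
def Sigma2 (s : ℕ → Creature2) (u : Finset ℕ) : Set Creature2 :=
  {t | ∃ hu : u.Nonempty,
    t.mdn = (s (u.min' hu)).mdn ∧ t.mup = (s (u.max' hu)).mup ∧
    ∃ l ∈ u, t.dis = (s l).dis ∧ t.val ⊆ (s l).val}

/- Pure candidates: m^{t_n}_up ≤ m^{t_{n+1}}_dn and nor[t_n] → ∞. -/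
def PC2 (t : ℕ → Creature2) : Prop :=
  (∀ n, (t n).mup ≤ (t (n + 1)).mdn) ∧
  Tendsto (fun n => (t n).nor) atTop atTop

/- t̄ ≤ s̄ iff there are finite nonempty u_n ⊆ ω with max(u_n) < min(u_{n+1}) and
t_n ∈ Σ_2(s̄↾u_n) for all n. -/
def le2 (t s : ℕ → Creature2) : Prop :=
  ∃ u : ℕ → Finset ℕ, (∀ n, (u n).Nonempty) ∧
    (∀ n, ∀ a ∈ u n, ∀ b ∈ u (n + 1), a < b) ∧
    ∀ n, t n ∈ Sigma2 s (u n)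

/- Membership in R(K_2, Σ_2): pure candidates with |val[t_l]| = l + 1 for all l. -/
def R2cond (t : ℕ → Creature2) : Prop :=
  PC2 t ∧ ∀ l, (t l).val.card = l + 1

/- r_k(t̄) = (t_0, …, t_{k−1}). -/
def restr2 (t : ℕ → Creature2) (k : ℕ) : List Creature2 :=
  List.ofFn (fun i : Fin k => t i.1)

/- pos(t̄) = ⋃_n val[t_n]. -/
def pos2 (t : ℕ → Creature2) : Set (ℕ → Option ℕ) :=
  ⋃ n, ((t n).val : Set (ℕ → Option ℕ))

/- STATEMENT 15 (Proposition RS2.11, Roslanowski–Shelah, recovered):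
For any t̄ ∈ PC_∞(K_2, Σ_2), any l ≥ 1, and any coloring d : pos(t̄) → l (modelled as a
total coloring taking values < l on pos(t̄)), there is s̄ ≤ t̄ in PC_∞(K_2, Σ_2) such
that d is constant on pos(s̄). -/
theorem stmt15 (t : ℕ → Creature2) (ht : PC2 t) (l : ℕ) (hl : 1 ≤ l)
    (d : (ℕ → Option ℕ) → ℕ) (hd : ∀ f ∈ pos2 t, d f < l) :
    ∃ s : ℕ → Creature2, PC2 s ∧ le2 s t ∧
      ∃ ε, ∀ f ∈ pos2 s, d f = ε := by
  classical
  have key : ∀ n, ∃ c, c < l ∧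
      (t n).val.card ≤ l * ((t n).val.filter (fun f => d f = c)).card := by
    intro n
    by_contra! hcon
    have h1 : (t n).val.card = ∑ c ∈ Finset.range l,
        ((t n).val.filter (fun f => d f = c)).card := by
      apply Finset.card_eq_sum_card_fiberwise
      intro f hf
      simpa using hd f (Set.mem_iUnion.2 ⟨n, hf⟩)
    have h2 : ∑ c ∈ Finset.range l, l * ((t n).val.filter (fun f => d f = c)).card
        < ∑ c ∈ Finset.range l, (t n).val.card := by
      apply Finset.sum_lt_sum_of_nonempty
      · exact ⟨0, by simp; omega⟩
      · intro c hc
        exact hcon c (by simpa using hc)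
    rw [← Finset.mul_sum, ← h1] at h2
    simp at h2
  choose c hcl hc using key
  have hfreq : ∃ ε, ∃ᶠ n in atTop, c n = ε := by
    by_contra! hcon
    have h1 : ∀ ε ∈ Finset.range l, ∀ᶠ n in atTop, ¬ c n = ε := by
      intro ε _
      exact hcon ε
    have h2 := (Filter.eventually_all_finset (Finset.range l)).2 h1
    obtain ⟨n, hn⟩ := h2.exists
    exact hn (c n) (by simpa using hcl n) rfl
  obtain ⟨ε, hε⟩ := hfreq
  obtain ⟨φ, hφ, hφc⟩ := Filter.extraction_of_frequently_atTop hε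
  have hcard : ∀ n, (t (φ n)).val.card ≤
      l * ((t (φ n)).val.filter (fun f => d f = ε)).card := by
    intro n
    have := hc (φ n)
    rwa [hφc n] at this
  have hpos : ∀ n, 0 < ((t (φ n)).val.filter (fun f => d f = ε)).card := by
    intro n
    have h1 := hcard n
    have h2 := (t (φ n)).hvalne.card_pos
    by_contra h0
    have : ((t (φ n)).val.filter (fun f => d f = ε)).card = 0 := by omega
    rw [this] at h1
    omega
  have hmono : ∀ a b, a < b → (t a).mup ≤ (t b).mdn := by
    intro a b hab
    induction b, hab using Nat.le_induction with
    | base => exact ht.1 a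
    | succ b hb ih => exact (ih.trans (t b).hm.le).trans (ht.1 b)
  refine ⟨fun n =>
    { mdn := (t (φ n)).mdn
      mup := (t (φ n)).mup
      hm := (t (φ n)).hm
      dis := (t (φ n)).dis
      hdisne := (t (φ n)).hdisne
      hdis := (t (φ n)).hdis
      val := (t (φ n)).val.filter (fun f => d f = ε)
      hvalne := Finset.card_pos.1 (hpos n)
      hdom := fun f hf => (t (φ n)).hdom f (Finset.mem_filter.1 hf).1
      hran := fun f hf => (t (φ n)).hran f (Finset.mem_filter.1 hf).1
      nor := _
      hnor := rfl }, ⟨?_, ?_⟩, ?_, ε, ?_⟩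
  · intro n
    exact hmono _ _ (hφ (Nat.lt_succ_self n))
  · have h1 : Tendsto (fun n => (t (φ n)).nor + -Real.logb 2 l) atTop atTop :=
      tendsto_atTop_add_const_right _ _ (ht.2.comp hφ.tendsto_atTop)
    refine tendsto_atTop_mono ?_ h1
    intro n
    have hl0 : (0 : ℝ) < l := by exact_mod_cast hl
    have hp : (0 : ℝ) < ((t (φ n)).val.filter (fun f => d f = ε)).card := by
      exact_mod_cast hpos n
    have hv : (0 : ℝ) < (t (φ n)).val.card := by
      exact_mod_cast (t (φ n)).hvalne.card_pos
    have hle : ((t (φ n)).val.card : ℝ) ≤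
        l * ((t (φ n)).val.filter (fun f => d f = ε)).card := by
      exact_mod_cast hcard n
    have h2 := Real.logb_le_logb_of_le (b := 2) (by norm_num) hv hle
    rw [Real.logb_mul hl0.ne' hp.ne'] at h2
    have h3 := (t (φ n)).hnor
    simp only
    linarith
  · refine ⟨fun n => {φ n}, fun n => Finset.singleton_nonempty _, ?_, ?_⟩
    · intro n a ha b hb
      rw [Finset.mem_singleton] at ha hb
      subst ha hb
      exact hφ (Nat.lt_succ_self n)
    · intro n
      exact ⟨Finset.singleton_nonempty _, by simp, by simp, φ n, by simp, rfl,
        Finset.filter_subset _ _⟩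
  · intro f hf
    obtain ⟨n, hn⟩ := Set.mem_iUnion.1 hf
    exact (Finset.mem_filter.1 hn).2
end
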